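/- arXiv:2011.10095 — 11 statements merged into one kernel-verified Lean document; each statement's English description precedes it below -/
import Mathlib

section
/- In a locally-aware constrained network game in which every action space is a finite-dimensional Euclidean space E i = EuclideanSpace ℝ (Fin (K i)), every action set U i is nonempty, convex and compact, every cost f i is continuous on the product space and, for every profile u, the map v ↦ f i (Function.update u i v) is convex on E i, every constraint function g m is continuous and, for every profile u and every i, the map v ↦ g m (Function.update u i v) is convex, and the following Slater-type condition holds: for every player i and every profile u with u j ∈ U j for all j, there exists v ∈ U i with g m (Function.update u i v) < 0 for every m ∈ A i — then the game possesses at least one generalized Nash equilibrium. -/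
section Scarf

variable {I T : Type*}

/-- A finite set is dominant for a family of rankings if no element beats, in every ranking,
the lowest-ranked element of the set. -/
def Dominant (r : I → T → ℕ) (σ : Finset T) : Prop :=
  ∀ y, ∃ i, ∀ x ∈ σ, r i y ≤ r i x

/-- `y` ranks strictly above the bound `μ i` in every ranking `i ≠ a`. -/
def AboveExcept (r : I → T → ℕ) (μ : I → T) (a : I) (y : T) : Prop :=
  ∀ i, i ≠ a → r i (μ i) < r i y

/-- `y` is the `a`-highest among the elements above the bound `μ` except at `a`. -/
def IsTopExcept (r : I → T → ℕ) (μ : I → T) (a : I) (y : T) : Prop :=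
  AboveExcept r μ a y ∧ ∀ z, AboveExcept r μ a z → r a z ≤ r a y

theorem Dominant.mono {r : I → T → ℕ} {σ τ : Finset T} (h : Dominant r σ) (hτ : τ ⊆ σ) :
    Dominant r τ := fun y ↦ (h y).imp fun _ hi x hx ↦ hi x (hτ hx)

theorem exists_isTopExcept [Finite T] {r : I → T → ℕ} {μ : I → T} {a : I}
    (h : ∃ y, AboveExcept r μ a y) : ∃ y, IsTopExcept r μ a y := by
  obtain ⟨y, hy, hmax⟩ := Set.exists_max_image {y | AboveExcept r μ a y} (r a) (Set.toFinite _) h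
  exact ⟨y, hy, hmax⟩

theorem IsTopExcept.unique {r : I → T → ℕ} (hr : ∀ i, Function.Injective (r i)) {μ : I → T}
    {a : I} {y z : T} (hy : IsTopExcept r μ a y) (hz : IsTopExcept r μ a z) : y = z :=
  hr a (le_antisymm (hz.2 _ hy.1) (hy.2 _ hz.1))

theorem AboveExcept.le {r : I → T → ℕ} {τ : Finset T} (hτ : Dominant r τ) {μ : I → T}
    (hμ : ∀ i, μ i ∈ τ) {a : I} {y : T} (hy : AboveExcept r μ a y) :
    ∀ x ∈ τ, r a y ≤ r a x := by
  obtain ⟨i, hi⟩ := hτ y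
  have hia : i = a := by
    by_contra hne
    exact absurd (hi _ (hμ i)) (not_le.2 (hy i hne))
  exact hia ▸ hi

theorem IsTopExcept.dominant_insert [DecidableEq T] {r : I → T → ℕ}
    (hr : ∀ i, Function.Injective (r i)) {τ : Finset T} (hτ : Dominant r τ) {μ : I → T}
    (hμ : ∀ i, μ i ∈ τ) (hmin : ∀ i, ∀ x ∈ τ, r i (μ i) ≤ r i x) {a b : I} (hab : a ≠ b)
    (hμab : μ a = μ b) {y : T} (hy : IsTopExcept r μ a y) :
    y ∉ τ ∧ Dominant r (insert y τ) := by
  have hle := hy.1.le hτ hμ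
  refine ⟨fun hyτ ↦ ?_, fun z ↦ ?_⟩
  · have h1 : y = μ a := hr a (le_antisymm (hle _ (hμ a)) (hmin a y hyτ))
    have h2 := hy.1 b hab.symm
    rw [h1, hμab] at h2
    exact lt_irrefl _ h2
  · by_cases hz : AboveExcept r μ a z
    · refine ⟨a, fun x hx ↦ ?_⟩
      rcases Finset.mem_insert.1 hx with rfl | hx
      · exact hy.2 z hz
      · exact (hy.2 z hz).trans (hle x hx)
    · simp only [AboveExcept, not_forall, not_lt] at hz
      obtain ⟨j, hja, hj⟩ := hz
      refine ⟨j, fun x hx ↦ ?_⟩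
      rcases Finset.mem_insert.1 hx with rfl | hx
      · exact hj.trans (hy.1 j hja).le
      · exact hj.trans (hmin j x hx)

theorem isTopExcept_of_dominant_insert [DecidableEq T] {r : I → T → ℕ}
    (hr : ∀ i, Function.Injective (r i)) {τ : Finset T} {μ : I → T}
    (hμ : ∀ i, μ i ∈ τ) (hmin : ∀ i, ∀ x ∈ τ, r i (μ i) ≤ r i x) {a b : I} (hab : a ≠ b)
    (ha : ∀ i j, i ≠ a → j ≠ a → μ i = μ j → i = j)
    (hb : ∀ i j, i ≠ b → j ≠ b → μ i = μ j → i = j)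
    {y : T} (hyτ : y ∉ τ) (hy : Dominant r (insert y τ)) :
    IsTopExcept r μ a y ∨ IsTopExcept r μ b y := by
  have key : ∀ i, ∃ l, μ l = μ i ∧ r l (μ l) < r l y := by
    intro i
    obtain ⟨l, hl⟩ := hy (μ i)
    have h1 : μ i = μ l := hr l (le_antisymm (hl _ (Finset.mem_insert_of_mem (hμ l)))
      (hmin l _ (hμ i)))
    refine ⟨l, h1.symm, lt_of_le_of_ne (h1 ▸ hl _ (Finset.mem_insert_self _ _)) fun h ↦ ?_⟩
    exact hyτ (hr l h ▸ hμ l)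
  have top : ∀ a, (∀ i j, i ≠ a → j ≠ a → μ i = μ j → i = j) → (∀ x ∈ τ, r a y ≤ r a x) →
      IsTopExcept r μ a y := by
    intro a ha hya
    have habove : AboveExcept r μ a y := by
      intro j hj
      obtain ⟨l, hl, hlt⟩ := key j
      have hla : l ≠ a := by
        rintro rfl
        exact absurd (hya _ (hμ l)) (not_le.2 hlt)
      exact ha l j hla hj hl ▸ hlt
    refine ⟨habove, fun z hz ↦ ?_⟩
    obtain ⟨i, hi⟩ := hy z
    have hia : i = a := by
      by_contra hne
      exact absurd (hi _ (Finset.mem_insert_of_mem (hμ i))) (not_le.2 (hz i hne))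
    exact hia ▸ hi _ (Finset.mem_insert_self _ _)
  obtain ⟨i, hi⟩ := hy y
  replace hi : ∀ x ∈ τ, r i y ≤ r i x := fun x hx ↦ hi x (Finset.mem_insert_of_mem hx)
  obtain ⟨l, hl, hlt⟩ := key i
  have hli : l ≠ i := by
    rintro rfl
    exact absurd (hi _ (hμ l)) (not_le.2 hlt)
  by_cases hia : i = a
  · subst hia
    exact Or.inl (top i ha hi)
  by_cases hib : i = b
  · subst hib
    exact Or.inr (top i hb hi)
  by_cases hla : l = a
  · exact absurd (hb l i (hla ▸ hab) hib hl) hli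
  · exact absurd (ha l i hla hia hl) hli

theorem exists_two_fibre_selector [Fintype I] {r : I → T → ℕ}
    (hr : ∀ i, Function.Injective (r i)) {τ : Finset T} (hτ : Dominant r τ) (hne : τ.Nonempty)
    (hcard : τ.card + 1 = Fintype.card I) :
    ∃ μ : I → T, (∀ i, μ i ∈ τ) ∧ (∀ i, ∀ x ∈ τ, r i (μ i) ≤ r i x) ∧
      ∃ a b, a ≠ b ∧ μ a = μ b ∧ (∀ i j, i ≠ a → j ≠ a → μ i = μ j → i = j) ∧
        (∀ i j, i ≠ b → j ≠ b → μ i = μ j → i = j) := by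
  classical
  choose μ hμ hmin using fun i ↦ Finset.exists_min_image τ (r i) hne
  obtain ⟨a, -, b, -, hab, hμab⟩ := Finset.exists_ne_map_eq_of_card_lt_of_maps_to
    (s := (Finset.univ : Finset I)) (t := τ) (f := μ) (by rw [Finset.card_univ]; omega)
    (fun i _ ↦ hμ i)
  have hsurj : ∀ x ∈ τ, ∃ i, μ i = x := fun x hx ↦ by
    obtain ⟨i, hi⟩ := hτ x
    exact ⟨i, hr i (le_antisymm (hmin i x hx) (hi _ (hμ i)))⟩
  have inj : ∀ a b, a ≠ b → μ a = μ b → ∀ i j, i ≠ a → j ≠ a → μ i = μ j → i = j := by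
    intro a b hab hμab i j hi hj hij
    have himg : (Finset.univ.erase a).image μ = τ := by
      ext x
      simp only [Finset.mem_image, Finset.mem_erase, Finset.mem_univ, and_true]
      refine ⟨fun ⟨i, _, h⟩ ↦ h ▸ hμ i, fun hx ↦ ?_⟩
      obtain ⟨i, rfl⟩ := hsurj x hx
      by_cases hia : i = a
      · exact ⟨b, hab.symm, by rw [hia, hμab]⟩
      · exact ⟨i, hia, rfl⟩
    have hinj : Set.InjOn μ (Finset.univ.erase a : Finset I) := by
      rw [← Finset.card_image_iff, himg, Finset.card_erase_of_mem (Finset.mem_univ _),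
        Finset.card_univ]
      omega
    exact hinj (by simpa using hi) (by simpa using hj) hij
  exact ⟨μ, hμ, hmin, a, b, hab, hμab, inj a b hab hμab, inj b a hab.symm hμab.symm⟩

/-- Deleting one element of a non-rainbow set leaves a set missing exactly the colour `i₀` in an
even number of ways. -/
theorem even_card_erase_of_image_ne [Fintype I] [DecidableEq I] [DecidableEq T] (c : T → I)
    (i₀ : I) {σ : Finset T} (hcard : σ.card = Fintype.card I) (hσ : σ.image c ≠ Finset.univ) :
    Even (σ.filter fun x ↦ (σ.erase x).image c = Finset.univ.erase i₀).card := by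
  rcases Finset.eq_empty_or_nonempty
    (σ.filter fun x ↦ (σ.erase x).image c = Finset.univ.erase i₀) with h | ⟨x, hx⟩
  · simp [h]
  obtain ⟨hxσ, hx⟩ := Finset.mem_filter.1 hx
  have hinj : Set.InjOn c (σ.erase x : Finset T) := by
    rw [← Finset.card_image_iff, hx, Finset.card_erase_of_mem (Finset.mem_univ _),
      Finset.card_erase_of_mem hxσ, hcard, Finset.card_univ]
  have himg : σ.image c = insert (c x) (Finset.univ.erase i₀) := by
    rw [← hx, ← Finset.image_insert, Finset.insert_erase hxσ]
  have hcx : c x ≠ i₀ := by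
    intro h
    exact hσ (by rw [himg, h, Finset.insert_erase (Finset.mem_univ _)])
  obtain ⟨y, hy, hyx⟩ := Finset.mem_image.1
    (show c x ∈ (σ.erase x).image c by rw [hx]; simpa using hcx)
  have hyne := (Finset.mem_erase.1 hy).1
  have hyσ := (Finset.mem_erase.1 hy).2
  have : (σ.filter fun x ↦ (σ.erase x).image c = Finset.univ.erase i₀) = {x, y} := by
    ext z
    simp only [Finset.mem_filter, Finset.mem_insert, Finset.mem_singleton]
    constructor
    · rintro ⟨hzσ, hz⟩
      by_contra! hcon
      obtain ⟨w, hw, hwz⟩ := Finset.mem_image.1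
        (show c z ∈ (σ.erase z).image c by
          rw [hz, ← hx]
          exact Finset.mem_image_of_mem c (Finset.mem_erase.2 ⟨hcon.1, hzσ⟩))
      have hwne := (Finset.mem_erase.1 hw).1
      have hwσ := (Finset.mem_erase.1 hw).2
      by_cases hwx : w = x
      · exact hcon.2 (hinj (by simp [hcon.1, hzσ]) (by simp [hyne, hyσ])
          (by rw [← hwz, hwx, hyx]))
      · exact hwne (hinj (by simp [hwx, hwσ]) (by simp [hcon.1, hzσ]) hwz)
    · rintro (rfl | rfl)
      · exact ⟨hxσ, hx⟩
      · refine ⟨hyσ, ?_⟩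
        rw [← hx]
        ext j
        simp only [Finset.mem_image, Finset.mem_erase]
        constructor
        · rintro ⟨w, ⟨hw1, hw2⟩, rfl⟩
          by_cases hwx : w = x
          · exact ⟨z, ⟨hyne, hyσ⟩, by rw [hwx, hyx]⟩
          · exact ⟨w, ⟨hwx, hw2⟩, rfl⟩
        · rintro ⟨w, ⟨hw1, hw2⟩, rfl⟩
          by_cases hwx : w = z
          · exact ⟨x, ⟨hyne.symm, hxσ⟩, by rw [hwx, hyx]⟩
          · exact ⟨w, ⟨hwx, hw2⟩, rfl⟩
  rw [this, Finset.card_pair hyne.symm]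
  exact even_two

theorem card_rooms_eq [Fintype I] [Fintype T] [DecidableEq T] {r : I → T → ℕ}
    {τ : Finset T} (hcard : τ.card + 1 = Fintype.card I) (Y : Finset T)
    (hY : ∀ y, y ∈ Y ↔ y ∉ τ ∧ Dominant r (insert y τ)) (R : Finset (Finset T))
    (hR : ∀ σ, σ ∈ R ↔ (Dominant r σ ∧ σ.card = Fintype.card I) ∧ τ ⊆ σ) :
    R.card = Y.card := by
  have : R = Y.image fun y ↦ insert y τ := by
    ext σ
    rw [hR, Finset.mem_image]
    constructor
    · rintro ⟨⟨hσ, hc⟩, hsub⟩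
      obtain ⟨y, hy, rfl⟩ := Finset.exists_eq_insert_iff.2 ⟨hsub, hcard.trans hc.symm⟩
      exact ⟨y, (hY y).2 ⟨hy, hσ⟩, rfl⟩
    · rintro ⟨y, hy, rfl⟩
      obtain ⟨h1, h2⟩ := (hY y).1 hy
      exact ⟨⟨h2, by rw [Finset.card_insert_of_notMem h1, hcard]⟩, Finset.subset_insert _ _⟩
  rw [this, Finset.card_image_iff]
  intro y hy z _ hyz
  have hmem : y ∈ insert z τ := by
    rw [← show insert y τ = insert z τ from hyz]
    exact Finset.mem_insert_self _ _
  exact (Finset.mem_insert.1 hmem).resolve_right ((hY y).1 hy).1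

/-- Scarf's lemma: with slack elements `d i`, lowest in ranking `i` and above all non-slack
elements in the others, every colouring with `d i` coloured `i` has a dominant set of all
colours. -/
theorem exists_dominant_image_eq_univ [Fintype I] [DecidableEq I] [Nontrivial I] [Fintype T]
    {r : I → T → ℕ} (hr : ∀ i, Function.Injective (r i)) (d : I → T)
    (hmin : ∀ i x, r i (d i) ≤ r i x)
    (hmax : ∀ x, x ∉ Set.range d → ∀ i j, j ≠ i → r i x < r i (d j))
    (hex : ∃ x, x ∉ Set.range d) (c : T → I) (hc : ∀ i, c (d i) = i) :
    ∃ σ : Finset T, Dominant r σ ∧ σ.card = Fintype.card I ∧ σ.image c = Finset.univ := by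
  classical
  by_contra! hcon
  obtain ⟨i₀⟩ : Nonempty I := inferInstance
  obtain ⟨x₀, hx₀⟩ := hex
  have hdinj : Function.Injective d := fun i j h ↦ by rw [← hc i, h, hc]
  have hlt : ∀ i x, x ≠ d i → r i (d i) < r i x := fun i x hx ↦
    lt_of_le_of_ne (hmin i x) fun h ↦ hx (hr i h.symm)
  set R : Finset (Finset T) :=
    Finset.univ.filter fun σ ↦ Dominant r σ ∧ σ.card = Fintype.card I with hR
  set D : Finset (Finset T) := Finset.univ.filter fun τ ↦
    Dominant r τ ∧ τ.card + 1 = Fintype.card I ∧ τ.image c = Finset.univ.erase i₀ with hD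
  set δ : Finset T := (Finset.univ.erase i₀).image d with hδ
  have hδcard : δ.card + 1 = Fintype.card I := by
    rw [hδ, Finset.card_image_of_injective _ hdinj, Finset.card_erase_of_mem (Finset.mem_univ _),
      Finset.card_univ]
    have := Fintype.card_pos (α := I)
    omega
  have hmemδ : ∀ i, i ≠ i₀ → d i ∈ δ := fun i hi ↦ by simp [hδ, hdinj.eq_iff, hi]
  have hδdom : Dominant r δ := by
    intro y
    by_cases hy : ∃ i, i ≠ i₀ ∧ y = d i
    · obtain ⟨i, -, rfl⟩ := hy
      exact ⟨i, fun x _ ↦ hmin i x⟩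
    · refine ⟨i₀, fun x hx ↦ ?_⟩
      obtain ⟨j, hj, rfl⟩ := Finset.mem_image.1 hx
      by_cases hyr : y ∈ Set.range d
      · obtain ⟨i, rfl⟩ := hyr
        have : i = i₀ := by
          by_contra h
          exact hy ⟨i, h, rfl⟩
        exact this ▸ hmin i _
      · exact (hmax y hyr i₀ j (by simpa using hj)).le
  have hδD : δ ∈ D := by
    refine Finset.mem_filter.2 ⟨Finset.mem_univ _, hδdom, hδcard, ?_⟩
    rw [hδ, Finset.image_image]
    simp [Function.comp_def, hc]
  have hmemR : ∀ τ σ, σ ∈ R.filter (fun σ ↦ τ ⊆ σ) ↔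
      (Dominant r σ ∧ σ.card = Fintype.card I) ∧ τ ⊆ σ := fun τ σ ↦ by
    simp [hR]
  have hroom : ∀ σ ∈ R, Even (D.filter fun τ ↦ τ ⊆ σ).card := by
    intro σ hσ
    obtain ⟨-, hdom, hcard⟩ := Finset.mem_filter.1 hσ
    have := even_card_erase_of_image_ne c i₀ hcard (hcon σ hdom hcard)
    convert this using 1
    rw [← Finset.card_image_of_injOn (s := σ.filter _) (f := fun x ↦ σ.erase x)]
    · congr 1
      ext τ
      simp only [hD, Finset.mem_filter, Finset.mem_univ, true_and, Finset.mem_image]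
      constructor
      · rintro ⟨⟨-, h2, h3⟩, hsub⟩
        obtain ⟨x, hx, rfl⟩ := Finset.exists_eq_insert_iff.2 ⟨hsub, h2.trans hcard.symm⟩
        exact ⟨x, ⟨Finset.mem_insert_self _ _, by rwa [Finset.erase_insert hx]⟩,
          Finset.erase_insert hx⟩
      · rintro ⟨x, ⟨hx, himg⟩, rfl⟩
        exact ⟨⟨hdom.mono (Finset.erase_subset _ _),
          (Finset.card_erase_add_one hx).trans hcard, himg⟩, Finset.erase_subset _ _⟩
    · intro x hx y _ hxy
      exact (Finset.erase_inj σ (Finset.mem_filter.1 hx).1).1 hxy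
  have hdoor : ∀ τ ∈ D, τ ≠ δ → Even (R.filter fun σ ↦ τ ⊆ σ).card := by
    intro τ hτ hne
    obtain ⟨-, hdom, hcard, himg⟩ := Finset.mem_filter.1 hτ
    obtain ⟨x, hxτ, hx⟩ : ∃ x ∈ τ, x ∉ Set.range d := by
      by_contra! h
      refine hne ?_
      ext x
      rw [hδ, Finset.mem_image, ← himg]
      constructor
      · intro hx
        obtain ⟨i, rfl⟩ := h x hx
        exact ⟨i, Finset.mem_image.2 ⟨d i, hx, hc i⟩, rfl⟩
      · rintro ⟨i, hi, rfl⟩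
        obtain ⟨y, hy, rfl⟩ := Finset.mem_image.1 hi
        obtain ⟨j, rfl⟩ := h y hy
        rwa [hc]
    obtain ⟨μ, hμ, hμmin, a, b, hab, hμab, ha, hb⟩ :=
      exists_two_fibre_selector hr hdom ⟨x, hxτ⟩ hcard
    have hdab : ∀ i j, i ≠ j → μ i = μ j → d i ∉ τ := by
      intro i j hij hμij hi
      have h1 : μ i = d i := hr i (le_antisymm (hμmin i _ hi) (hmin i _))
      have h2 := hμmin j x hxτ
      rw [← hμij, h1] at h2
      exact absurd h2 (not_le.2 (hmax x hx j i hij))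
    have habove : ∀ a, d a ∉ τ → AboveExcept r μ a (d a) := by
      intro a ha i hi
      by_cases h : μ i ∈ Set.range d
      · obtain ⟨j, hj⟩ := h
        have hji : j = i := by
          by_contra hji
          have h2 := hμmin i x hxτ
          rw [← hj] at h2
          exact absurd h2 (not_le.2 (hmax x hx i j hji))
        rw [← hj, hji]
        exact hlt i _ fun h ↦ hi (hdinj h).symm
      · exact hmax _ h i a hi.symm
    obtain ⟨y, hy⟩ := exists_isTopExcept ⟨_, habove a (hdab a b hab hμab)⟩
    obtain ⟨z, hz⟩ := exists_isTopExcept ⟨_, habove b (hdab b a hab.symm hμab.symm)⟩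
    have hyz : y ≠ z := by
      rintro rfl
      exact absurd (hy.1.le hdom hμ _ (hμ a)) (not_le.2 (hz.1 a hab))
    rw [card_rooms_eq hcard {y, z} _ _ (hmemR τ), Finset.card_pair hyz]
    · exact even_two
    · intro w
      simp only [Finset.mem_insert, Finset.mem_singleton]
      constructor
      · rintro (rfl | rfl)
        · exact hy.dominant_insert hr hdom hμ hμmin hab hμab
        · exact hz.dominant_insert hr hdom hμ hμmin hab.symm hμab.symm
      · rintro ⟨hw, hwd⟩
        rcases isTopExcept_of_dominant_insert hr hμ hμmin hab ha hb hw hwd with h | h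
        · exact Or.inl (h.unique hr hy)
        · exact Or.inr (h.unique hr hz)
  have hδone : (R.filter fun σ ↦ δ ⊆ σ).card = 1 := by
    obtain ⟨j₀, hj₀⟩ := exists_ne i₀
    obtain ⟨μ, hμ, hμmin, a, b, hab, hμab, ha, hb⟩ :=
      exists_two_fibre_selector hr hδdom ⟨_, hmemδ j₀ hj₀⟩ hδcard
    have hμd : ∀ i, i ≠ i₀ → μ i = d i := fun i hi ↦
      hr i (le_antisymm (hμmin i _ (hmemδ i hi)) (hmin i _))
    have main : ∀ b, b ≠ i₀ → μ i₀ = μ b →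
        (∀ i j, i ≠ i₀ → j ≠ i₀ → μ i = μ j → i = j) →
        (∀ i j, i ≠ b → j ≠ b → μ i = μ j → i = j) →
        (R.filter fun σ ↦ δ ⊆ σ).card = 1 := by
      intro b hbi hμb ha hb
      have hx : AboveExcept r μ i₀ x₀ := fun i hi ↦ by
        rw [hμd i hi]
        exact hlt i _ fun h ↦ hx₀ ⟨i, h.symm⟩
      obtain ⟨y, hy⟩ := exists_isTopExcept ⟨_, hx⟩
      rw [card_rooms_eq hδcard {y} _ _ (hmemR δ), Finset.card_singleton]
      intro w
      rw [Finset.mem_singleton]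
      constructor
      · rintro rfl
        exact hy.dominant_insert hr hδdom hμ hμmin hbi.symm hμb
      · rintro ⟨hw, hwd⟩
        rcases isTopExcept_of_dominant_insert hr hμ hμmin hbi.symm ha hb hw hwd with h | h
        · exact h.unique hr hy
        · exfalso
          have h1 := h.1 i₀ hbi.symm
          rw [hμb, hμd b hbi] at h1
          by_cases hwr : w ∈ Set.range d
          · obtain ⟨j, rfl⟩ := hwr
            by_cases hj : j = i₀
            · rw [hj] at h1
              exact absurd (hmin i₀ _) (not_le.2 h1)
            · exact hw (hmemδ j hj)
          · exact absurd (hmax w hwr i₀ b hbi) (not_lt.2 h1.le)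
    by_cases hai : a = i₀
    · subst hai
      exact main b hab.symm hμab ha hb
    by_cases hbi : b = i₀
    · subst hbi
      exact main a hab hμab.symm hb ha
    · rw [hμd a hai, hμd b hbi] at hμab
      exact absurd (hdinj hμab) hab
  have hcount : ∑ σ ∈ R, (D.filter fun τ ↦ τ ⊆ σ).card =
      ∑ τ ∈ D, (R.filter fun σ ↦ τ ⊆ σ).card := by
    simpa [Finset.bipartiteAbove, Finset.bipartiteBelow] using
      (Finset.sum_card_bipartiteAbove_eq_sum_card_bipartiteBelow
        (s := D) (t := R) (fun τ σ ↦ τ ⊆ σ)).symm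
  have h1 : Even (∑ σ ∈ R, (D.filter fun τ ↦ τ ⊆ σ).card) := Finset.even_sum _ hroom
  rw [hcount, ← Finset.add_sum_erase _ _ hδD, hδone] at h1
  have h2 : Even (∑ τ ∈ D.erase δ, (R.filter fun σ ↦ τ ⊆ σ).card) :=
    Finset.even_sum _ fun τ hτ ↦ hdoor τ (Finset.mem_of_mem_erase hτ) (Finset.ne_of_mem_erase hτ)
  rw [Nat.even_add] at h1
  exact Nat.not_even_one (h1.2 h2)

end Scarf

section Brouwer

theorem exists_injective_refinement {I T : Type*} [Finite T] (v : I → T → ℕ) :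
    ∃ r : I → T → ℕ, (∀ i, Function.Injective (r i)) ∧
      ∀ i x y, v i x < v i y → r i x < r i y := by
  obtain ⟨N, ⟨e⟩⟩ := Finite.exists_equiv_fin T
  refine ⟨fun i x ↦ v i x * N + e x, fun i x y hxy ↦ ?_, fun i x y hxy ↦ ?_⟩
  · have h1 := congrArg (· % N) hxy
    simp only [Nat.mul_add_mod_self_right, Nat.mod_eq_of_lt (e x).2,
      Nat.mod_eq_of_lt (e y).2] at h1
    exact e.injective (Fin.ext h1)
  · have h1 : (v i x + 1) * N ≤ v i y * N := Nat.mul_le_mul_right _ hxy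
    have h2 := (e x).2
    have h3 : (v i x + 1) * N = v i x * N + N := by ring
    dsimp only
    omega

/-- Every colouring of the grid points of a dilated simplex has a small cluster of points
exhibiting all colours, up to the coordinates that almost vanish. -/
theorem exists_grid_cluster {I : Type*} [Fintype I] [Nontrivial I] (k : ℕ) (c : (I → ℕ) → I) :
    ∃ z : I → ℕ, ∑ i, z i = k ∧ ∀ i, ∃ w : I → ℕ, ∑ j, w j = k ∧
      (∀ j, w j ≤ z j + Fintype.card I ∧ z j ≤ w j + Fintype.card I) ∧
      (c w = i ∨ w i ≤ Fintype.card I) := by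
  classical
  set G := Finset.piAntidiag (Finset.univ : Finset I) k with hG
  have hmemG : ∀ x, x ∈ G ↔ ∑ i, x i = k := fun x ↦ by simp [hG]
  have hle : ∀ x : G, ∀ i, x.1 i ≤ k := fun x i ↦ by
    rw [← (hmemG _).1 x.2]
    exact Finset.single_le_sum (fun _ _ ↦ Nat.zero_le _) (Finset.mem_univ i)
  obtain ⟨i₀⟩ : Nonempty I := inferInstance
  obtain ⟨r, hr, hvr⟩ := exists_injective_refinement (I := I) (T := I ⊕ G)
    (fun i ↦ Sum.elim (fun j ↦ if i = j then 0 else k + 2) fun x ↦ x.1 i + 1)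
  have hvr' : ∀ i x y, r i x ≤ r i y → _ := fun i x y h ↦
    not_lt.1 fun h' ↦ absurd (hvr i y x h') (not_lt.2 h)
  have hbase : Pi.single i₀ k ∈ G := by simp [hmemG]
  have hslack : ∀ i (x : G), ¬ r i (Sum.inr x) ≤ r i (Sum.inl i) := fun i x h ↦ by
    simpa using hvr' _ _ _ h
  obtain ⟨σ, hσ, hcard, himg⟩ := exists_dominant_image_eq_univ hr Sum.inl
    (fun i x ↦ by
      by_cases hx : x = Sum.inl i
      · rw [hx]
      · refine (hvr i _ _ ?_).le
        rcases x with j | x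
        · have : i ≠ j := fun h ↦ hx (by rw [h])
          simp [this]
        · simp)
    (fun x hx i j hji ↦ by
      rcases x with l | x
      · exact absurd ⟨l, rfl⟩ hx
      · refine hvr i _ _ ?_
        have := hle x i
        simp only [Sum.elim_inr, Sum.elim_inl, if_neg hji.symm]
        omega)
    ⟨Sum.inr ⟨_, hbase⟩, by simp⟩ (Sum.elim id fun x ↦ c x.1) (fun _ ↦ rfl)
  have hcol : ∀ i, Sum.inl i ∈ σ ∨ ∃ x : G, Sum.inr x ∈ σ ∧ c x.1 = i := fun i ↦ by
    obtain ⟨x, hx, hxi⟩ := Finset.mem_image.1 (himg ▸ Finset.mem_univ i)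
    rcases x with j | x
    · exact Or.inl (by simpa [← hxi] using hx)
    · exact Or.inr ⟨x, hx, hxi⟩
  obtain ⟨z, hz⟩ : ∃ z : G, Sum.inr z ∈ σ := by
    by_contra! hno
    obtain ⟨i, hi⟩ := hσ (Sum.inr ⟨_, hbase⟩)
    rcases hcol i with h | ⟨x, hx, -⟩
    · exact hslack _ _ (hi _ h)
    · exact hno x hx
  choose p hp hpmin using fun i ↦ Finset.exists_min_image
    (Finset.univ.filter fun x : G ↦ Sum.inr x ∈ σ) (fun x ↦ x.1 i) ⟨z, by simpa using hz⟩
  simp only [Finset.mem_filter, Finset.mem_univ, true_and] at hp hpmin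
  set m : I → ℕ := fun i ↦ if Sum.inl i ∈ σ then 0 else (p i).1 i with hm
  have hmle : ∀ x : G, Sum.inr x ∈ σ → ∀ i, m i ≤ x.1 i := fun x hx i ↦ by
    by_cases h : Sum.inl i ∈ σ
    · simp [hm, h]
    · simpa [hm, h] using hpmin i x hx
  have hsum : k < ∑ i, (m i + 1) := by
    by_contra! hsum
    set y : I → ℕ := fun i ↦ m i + 1 + (Pi.single i₀ (k - ∑ i, (m i + 1)) : I → ℕ) i with hy
    have hyG : y ∈ G := by
      rw [hmemG, hy, Finset.sum_add_distrib]
      simp only [Finset.sum_pi_single', Finset.mem_univ, if_true]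
      omega
    obtain ⟨i, hi⟩ := hσ (Sum.inr ⟨y, hyG⟩)
    by_cases h : Sum.inl i ∈ σ
    · exact hslack _ _ (hi _ h)
    · have h1 := hvr' _ _ _ (hi _ (hp i))
      simp only [Sum.elim_inr, hy, hm, if_neg h] at h1
      omega
  rw [Finset.sum_add_distrib] at hsum
  simp only [Finset.sum_const, Finset.card_univ, smul_eq_mul, mul_one] at hsum
  have hclose : ∀ x : G, Sum.inr x ∈ σ → ∀ i, x.1 i ≤ m i + Fintype.card I := fun x hx i ↦ by
    have h1 : ∑ j, (x.1 j - m j) + ∑ j, m j = k := by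
      rw [← Finset.sum_add_distrib, ← (hmemG _).1 x.2]
      exact Finset.sum_congr rfl fun j _ ↦ Nat.sub_add_cancel (hmle x hx j)
    have h2 : x.1 i - m i ≤ ∑ j, (x.1 j - m j) :=
      Finset.single_le_sum (f := fun j ↦ x.1 j - m j) (fun _ _ ↦ Nat.zero_le _)
        (Finset.mem_univ i)
    omega
  refine ⟨z.1, (hmemG _).1 z.2, fun i ↦ ?_⟩
  rcases hcol i with h | ⟨x, hx, hxi⟩
  · refine ⟨z.1, (hmemG _).1 z.2, fun j ↦ by omega, Or.inr ?_⟩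
    simpa [hm, h] using hclose z hz i
  · refine ⟨x.1, (hmemG _).1 x.2, fun j ↦ ?_, Or.inl hxi⟩
    have h1 := hclose x hx j
    have h2 := hclose z hz j
    have h3 := hmle x hx j
    have h4 := hmle z hz j
    omega

/-- Brouwer's fixed point theorem for the standard simplex. -/
theorem exists_fixedPoint_stdSimplex {I : Type*} [Fintype I] [Nonempty I]
    (F : (I → ℝ) → I → ℝ) (hF : ContinuousOn F (stdSimplex ℝ I))
    (hmaps : Set.MapsTo F (stdSimplex ℝ I) (stdSimplex ℝ I)) :
    ∃ x ∈ stdSimplex ℝ I, F x = x := by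
  classical
  rcases subsingleton_or_nontrivial I with hI | hI
  · have hone : ∀ x ∈ stdSimplex ℝ I, ∀ i, x i = 1 := fun x hx i ↦ by
      have := hx.2
      rwa [Fintype.sum_subsingleton _ i] at this
    obtain ⟨i₀⟩ : Nonempty I := inferInstance
    refine ⟨Pi.single i₀ 1, single_mem_stdSimplex ℝ i₀, funext fun i ↦ ?_⟩
    rw [hone _ (hmaps (single_mem_stdSimplex ℝ i₀)), hone _ (single_mem_stdSimplex ℝ i₀)]
  set n : ℝ := (Fintype.card I : ℝ) with hn
  have hexists : ∀ x ∈ stdSimplex ℝ I, ∃ i, x i ≤ F x i := fun x hx ↦ by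
    by_contra! h
    have := Finset.sum_lt_sum_of_nonempty Finset.univ_nonempty fun i _ ↦ h i
    rw [hx.2, (hmaps hx).2] at this
    exact lt_irrefl _ this
  have happrox : ∀ k : ℕ, ∃ z ∈ stdSimplex ℝ I, ∀ i, ∃ w ∈ stdSimplex ℝ I,
      dist w z ≤ n / (k + 1 : ℝ) ∧ w i ≤ F w i + n / (k + 1 : ℝ) := by
    intro k
    have hk : (0 : ℝ) < k + 1 := by positivity
    have hmem : ∀ x : I → ℕ, ∑ i, x i = k + 1 →
        (fun i ↦ (x i : ℝ) / (k + 1)) ∈ stdSimplex ℝ I := fun x hx ↦ by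
      refine ⟨fun i ↦ by positivity, ?_⟩
      rw [← Finset.sum_div, div_eq_one_iff_eq hk.ne']
      exact_mod_cast hx
    have hc : ∀ x : I → ℕ, ∃ i, ∑ i, x i = k + 1 →
        (x i : ℝ) / (k + 1) ≤ F (fun i ↦ (x i : ℝ) / (k + 1)) i := fun x ↦ by
      by_cases hx : ∑ i, x i = k + 1
      · obtain ⟨i, hi⟩ := hexists _ (hmem x hx)
        exact ⟨i, fun _ ↦ hi⟩
      · exact ⟨Classical.arbitrary I, fun h ↦ absurd h hx⟩
    choose c hc using hc
    obtain ⟨z, hz, hzw⟩ := exists_grid_cluster (k + 1) c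
    refine ⟨_, hmem z hz, fun i ↦ ?_⟩
    obtain ⟨w, hw, hwz, hwi⟩ := hzw i
    refine ⟨_, hmem w hw, ?_, ?_⟩
    · rw [dist_pi_le_iff (by positivity)]
      intro j
      rw [Real.dist_eq, ← sub_div, abs_div, abs_of_pos hk]
      gcongr
      obtain ⟨h1, h2⟩ := hwz j
      have h1' : (w j : ℝ) ≤ z j + n := by rw [hn]; exact_mod_cast h1
      have h2' : (z j : ℝ) ≤ w j + n := by rw [hn]; exact_mod_cast h2
      exact abs_sub_le_iff.2 ⟨by linarith, by linarith⟩
    · rcases hwi with rfl | hwi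
      · exact (hc w hw).trans (le_add_of_nonneg_right (by positivity))
      · have h1 : (w i : ℝ) / (k + 1) ≤ n / (k + 1) := by
          rw [hn]
          gcongr
        exact h1.trans (le_add_of_nonneg_left ((hmaps (hmem w hw)).1 i))
  choose z hz w hw hwz hwF using happrox
  obtain ⟨x, hx, φ, hφ, hzx⟩ := (isCompact_stdSimplex ℝ I).tendsto_subseq hz
  have hlim : Filter.Tendsto (fun k : ℕ ↦ n / (k + 1 : ℝ)) Filter.atTop (nhds 0) := by
    simpa [div_eq_mul_inv] using (tendsto_one_div_add_atTop_nhds_zero_nat (𝕜 := ℝ)).const_mul n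
  have hlimφ := hlim.comp hφ.tendsto_atTop
  have hle : ∀ i, x i ≤ F x i := by
    intro i
    have hwx : Filter.Tendsto (fun k ↦ w (φ k) i) Filter.atTop (nhds x) := by
      refine hzx.congr_dist ?_
      refine squeeze_zero (fun _ ↦ dist_nonneg) (fun k ↦ ?_) hlimφ
      rw [dist_comm]
      exact hwz (φ k) i
    have hwx' : Filter.Tendsto (fun k ↦ w (φ k) i) Filter.atTop
        (nhdsWithin x (stdSimplex ℝ I)) :=
      tendsto_nhdsWithin_iff.2 ⟨hwx, Filter.Eventually.of_forall fun k ↦ hw _ i⟩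
    have hFw := tendsto_pi_nhds.1 ((hF x hx).tendsto.comp hwx') i
    have h2 := hFw.add hlimφ
    rw [add_zero] at h2
    exact le_of_tendsto_of_tendsto' (tendsto_pi_nhds.1 hwx i) h2 fun k ↦ hwF _ i
  refine ⟨x, hx, funext fun i ↦ ?_⟩
  have hsum : ∑ i, x i = ∑ i, F x i := by rw [hx.2, (hmaps hx).2]
  exact ((Finset.sum_eq_sum_iff_of_le fun i _ ↦ hle i).1 hsum i (Finset.mem_univ i)).symm

/-- Browder's fixed point theorem: a convex-valued correspondence on a compact convex set that
locally admits constant selections has a fixed point. -/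
theorem exists_mem_of_locally_const_selection {E : Type*} [AddCommGroup E] [Module ℝ E]
    [TopologicalSpace E] [T2Space E] [ContinuousAdd E] [ContinuousSMul ℝ E]
    {X : Set E} (hXcomp : IsCompact X) (hXconv : Convex ℝ X) (hXne : X.Nonempty)
    (t : E → Set E) (htconv : ∀ x ∈ X, Convex ℝ (t x))
    (ht : ∀ x ∈ X, ∃ s ∈ X, ∀ᶠ y in nhdsWithin x X, s ∈ t y) :
    ∃ x ∈ X, x ∈ t x := by
  classical
  have : CompactSpace X := isCompact_iff_compactSpace.1 hXcomp
  choose s hsX hs using fun x : X ↦ ht x x.2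
  have hV : ∀ x : X, ∃ V : Set X, IsOpen V ∧ x ∈ V ∧ ∀ y ∈ V, s x ∈ t y := fun x ↦ by
    have h1 : ∀ᶠ y : X in nhds x, s x ∈ t y := by
      rw [nhds_subtype_eq_comap_nhdsWithin]
      exact (hs x).comap _
    obtain ⟨V, hV, hVo, hxV⟩ := eventually_nhds_iff.1 h1
    exact ⟨V, hVo, hxV, hV⟩
  choose V hVo hxV hVt using hV
  obtain ⟨J, hJ⟩ := isCompact_univ.elim_finite_subcover V hVo
    fun x _ ↦ Set.mem_iUnion.2 ⟨x, hxV x⟩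
  obtain ⟨ρ, hρ⟩ := PartitionOfUnity.exists_isSubordinate isClosed_univ (fun j : J ↦ V j)
    (fun j ↦ hVo j) (by simpa [Set.iUnion_subtype] using hJ)
  have hρsum : ∀ x : X, ∑ j, ρ j x = 1 := fun x ↦ by
    rw [← finsum_eq_sum_of_fintype]
    exact ρ.sum_eq_one (Set.mem_univ x)
  have hJne : Nonempty J := by
    obtain ⟨x, hx⟩ := hXne
    obtain ⟨j, hj, -⟩ := Set.mem_iUnion₂.1 (hJ (Set.mem_univ (⟨x, hx⟩ : X)))
    exact ⟨⟨j, hj⟩⟩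
  set comb : (J → ℝ) → E := fun a ↦ ∑ j, a j • s j with hcomb
  have hcombX : ∀ a ∈ stdSimplex ℝ J, comb a ∈ X := fun a ha ↦
    hXconv.sum_mem (fun j _ ↦ ha.1 j) ha.2 fun j _ ↦ hsX j
  have hcombcont : Continuous comb := by fun_prop
  obtain ⟨a, ha, hfix⟩ := exists_fixedPoint_stdSimplex
    (fun a j ↦ if h : comb a ∈ X then ρ j ⟨comb a, h⟩ else 0)
    (by
      rw [continuousOn_iff_continuous_domRestrict]
      refine continuous_pi fun j ↦ ?_
      have : Continuous fun a : stdSimplex ℝ J ↦ ρ j ⟨comb a.1, hcombX a.1 a.2⟩ :=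
        (ρ j).continuous.comp
          ((hcombcont.comp continuous_subtype_val).subtype_mk _)
      convert this using 2 with b
      exact dif_pos (hcombX b.1 b.2))
    (fun a ha ↦ ⟨fun j ↦ by
      simp only [hcombX a ha, dif_pos]
      exact ρ.nonneg _ _, by simpa [hcombX a ha] using hρsum ⟨comb a, hcombX a ha⟩⟩)
  refine ⟨comb a, hcombX a ha, ?_⟩
  have haρ : ∀ j, a j = ρ j ⟨comb a, hcombX a ha⟩ := fun j ↦ by
    conv_lhs => rw [← hfix]
    simp [hcombX a ha]
  have hmem : ∀ j, a j ≠ 0 → s j ∈ t (comb a) := fun j hj ↦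
    hVt j ⟨comb a, hcombX a ha⟩ (hρ j (subset_tsupport _ (by
      rw [Function.mem_support, ← haρ]
      exact hj)))
  have hsupp : ∑ j ∈ Finset.univ.filter (fun j ↦ a j ≠ 0), a j • s j = comb a :=
    Finset.sum_filter_of_ne fun j _ h h0 ↦ h (by rw [h0, zero_smul])
  have hsum := (htconv _ (hcombX a ha)).sum_mem (t := Finset.univ.filter fun j ↦ a j ≠ 0)
    (fun j _ ↦ ha.1 j) (by rw [Finset.sum_filter_ne_zero, ha.2])
    fun j hj ↦ hmem j (Finset.mem_filter.1 hj).2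
  rwa [hsupp] at hsum

end Brouwer

section Equilibrium

/-- Under Slater's condition, the strictly feasible points of a convex program are dense among
the feasible ones. -/
theorem mem_closure_strictly_feasible {E M : Type*} [AddCommGroup E] [Module ℝ E]
    [TopologicalSpace E] [ContinuousAdd E] [ContinuousSMul ℝ E] {S : Set E} (hS : Convex ℝ S)
    {A : Set M} {h : M → E → ℝ} (hconv : ∀ m, ConvexOn ℝ Set.univ (h m)) {v₀ v : E}
    (hv₀ : v₀ ∈ S) (hlt : ∀ m ∈ A, h m v₀ < 0) (hv : v ∈ S) (hle : ∀ m ∈ A, h m v ≤ 0) :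
    v ∈ closure {w ∈ S | ∀ m ∈ A, h m w < 0} := by
  have hlim : Filter.Tendsto (fun t : ℝ ↦ (1 - t) • v + t • v₀) (nhdsWithin 0 (Set.Ioi 0))
      (nhds v) := by
    have : Continuous fun t : ℝ ↦ (1 - t) • v + t • v₀ := by fun_prop
    simpa using (this.tendsto 0).mono_left nhdsWithin_le_nhds
  refine mem_closure_of_tendsto hlim ?_
  filter_upwards [Ioo_mem_nhdsGT (zero_lt_one' ℝ)] with t ⟨ht0, ht1⟩
  refine ⟨hS hv hv₀ (by linarith) ht0.le (by ring), fun m hm ↦ ?_⟩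
  have h1 := (hconv m).2 (Set.mem_univ v) (Set.mem_univ v₀) (sub_nonneg.2 ht1.le) ht0.le
    (sub_add_cancel 1 t)
  simp only [smul_eq_mul] at h1
  nlinarith [mul_neg_of_pos_of_neg ht0 (hlt m hm),
    mul_nonpos_of_nonneg_of_nonpos (sub_nonneg.2 ht1.le) (hle m hm)]

variable {ι M : Type*} [DecidableEq ι] {E : ι → Type*} [∀ i, TopologicalSpace (E i)]

theorem eventually_strictly_feasible_near_optimal [Finite M] {U : ∀ i, Set (E i)}
    (hUcomp : ∀ i, IsCompact (U i))
    {f : ι → (∀ i, E i) → ℝ} (hfcont : ∀ i, Continuous (f i))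
    {g : M → (∀ i, E i) → ℝ} (hgcont : ∀ m, Continuous (g m))
    {A : Set M} {i : ι} {u : ∀ j, E j} {s : E i} {δ : ℝ}
    (hsg : ∀ m ∈ A, g m (Function.update u i s) < 0)
    (hsf : ∀ v ∈ U i, (∀ m ∈ A, g m (Function.update u i v) ≤ 0) →
      f i (Function.update u i s) < f i (Function.update u i v) + δ) :
    ∀ᶠ y in nhds u, (∀ m ∈ A, g m (Function.update y i s) < 0) ∧
      ∀ v ∈ U i, (∀ m ∈ A, g m (Function.update y i v) ≤ 0) →
        f i (Function.update y i s) < f i (Function.update y i v) + δ := by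
  have hupd : Continuous fun p : (∀ j, E j) × E i ↦ Function.update p.1 i p.2 :=
    continuous_fst.update i continuous_snd
  have hupds : Continuous fun y : ∀ j, E j ↦ Function.update y i s :=
    continuous_id.update i continuous_const
  refine Filter.Eventually.and ?_ ?_
  · rw [Filter.eventually_all_finite (Set.toFinite A)]
    exact fun m hm ↦ ((hgcont m).comp hupds).continuousAt.eventually_lt continuousAt_const
      (hsg m hm)
  · refine (hUcomp i).eventually_forall_of_forall_eventually fun v hv ↦ ?_
    by_cases hfeas : ∀ m ∈ A, g m (Function.update u i v) ≤ 0
    · have h1 : ∀ᶠ p : (∀ j, E j) × E i in nhds (u, v),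
          f i (Function.update p.1 i s) < f i (Function.update p.1 i p.2) + δ :=
        (((hfcont i).comp hupds).comp continuous_fst).continuousAt.eventually_lt
          (((hfcont i).comp hupd).add continuous_const).continuousAt (hsf v hv hfeas)
      exact h1.mono fun p hp _ ↦ hp
    · push Not at hfeas
      obtain ⟨m, hm, hpos⟩ := hfeas
      have h1 : ∀ᶠ p : (∀ j, E j) × E i in nhds (u, v), 0 < g m (Function.update p.1 i p.2) :=
        continuousAt_const.eventually_lt ((hgcont m).comp hupd).continuousAt hpos
      exact h1.mono fun p hp h ↦ absurd (h m hm) (not_le.2 hp)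

variable [∀ i, AddCommGroup (E i)] [∀ i, Module ℝ (E i)] [∀ i, ContinuousAdd (E i)]
  [∀ i, ContinuousSMul ℝ (E i)]

theorem exists_strictly_feasible_near_optimal {U : ∀ i, Set (E i)}
    (hUconv : ∀ i, Convex ℝ (U i)) (hUcomp : ∀ i, IsCompact (U i))
    {f : ι → (∀ i, E i) → ℝ} (hfcont : ∀ i, Continuous (f i))
    {g : M → (∀ i, E i) → ℝ} (hgcont : ∀ m, Continuous (g m))
    (hgconv : ∀ m (u : ∀ j, E j) (i : ι),
      ConvexOn ℝ Set.univ (fun v ↦ g m (Function.update u i v)))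
    {A : Set M} {i : ι} {u : ∀ j, E j}
    (hSlater : ∃ v ∈ U i, ∀ m ∈ A, g m (Function.update u i v) < 0) {δ : ℝ} (hδ : 0 < δ) :
    ∃ s ∈ U i, (∀ m ∈ A, g m (Function.update u i s) < 0) ∧
      ∀ v ∈ U i, (∀ m ∈ A, g m (Function.update u i v) ≤ 0) →
        f i (Function.update u i s) < f i (Function.update u i v) + δ := by
  obtain ⟨v₀, hv₀, hlt⟩ := hSlater
  have hupd : Continuous fun v ↦ Function.update u i v := continuous_const.update i continuous_id
  have hclosed : IsClosed {v | ∀ m ∈ A, g m (Function.update u i v) ≤ 0} := by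
    simp only [Set.ofPred_forall]
    exact isClosed_biInter fun m _ ↦ isClosed_le ((hgcont m).comp hupd) continuous_const
  obtain ⟨v, ⟨hvU, hv⟩, hmin⟩ := ((hUcomp i).inter_right hclosed).exists_isMinOn
    ⟨v₀, hv₀, fun m hm ↦ (hlt m hm).le⟩ ((hfcont i).comp hupd).continuousOn
  have hopen : IsOpen {w | f i (Function.update u i w) < f i (Function.update u i v) + δ} :=
    isOpen_lt ((hfcont i).comp hupd) continuous_const
  obtain ⟨s, hs, hsU, hsg⟩ := mem_closure_iff.1
    (mem_closure_strictly_feasible (hUconv i) (fun m ↦ hgconv m u i) hv₀ hlt hvU hv) _ hopen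
    (by simpa using hδ)
  exact ⟨s, hsU, hsg, fun w hw hwg ↦ lt_of_lt_of_le hs (by
    have : f i (Function.update u i v) ≤ f i (Function.update u i w) := hmin ⟨hw, hwg⟩
    linarith)⟩

theorem exists_approximate_equilibrium [Finite ι] [Finite M] [∀ i, T2Space (E i)]
    {U : ∀ i, Set (E i)}
    (hUne : ∀ i, (U i).Nonempty)
    (hUconv : ∀ i, Convex ℝ (U i)) (hUcomp : ∀ i, IsCompact (U i))
    {f : ι → (∀ i, E i) → ℝ} (hfcont : ∀ i, Continuous (f i))
    (hfconv : ∀ i (u : ∀ j, E j), ConvexOn ℝ Set.univ (fun v ↦ f i (Function.update u i v)))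
    {g : M → (∀ i, E i) → ℝ} (hgcont : ∀ m, Continuous (g m))
    (hgconv : ∀ m (u : ∀ j, E j) (i : ι),
      ConvexOn ℝ Set.univ (fun v ↦ g m (Function.update u i v)))
    {A : ι → Set M}
    (hSlater : ∀ (i : ι) (u : ∀ j, E j), (∀ j, u j ∈ U j) →
      ∃ v ∈ U i, ∀ m ∈ A i, g m (Function.update u i v) < 0) {δ : ℝ} (hδ : 0 < δ) :
    ∃ u : ∀ i, E i, (∀ i, u i ∈ U i) ∧ ∀ i, (∀ m ∈ A i, g m u < 0) ∧
      ∀ v ∈ U i, (∀ m ∈ A i, g m (Function.update u i v) ≤ 0) →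
        f i u < f i (Function.update u i v) + δ := by
  obtain ⟨u, hu, hut⟩ := exists_mem_of_locally_const_selection
    (isCompact_univ_pi hUcomp) (convex_pi fun i _ ↦ hUconv i) (Set.univ_pi_nonempty_iff.2 hUne)
    (fun u ↦ {w | ∀ i, (∀ m ∈ A i, g m (Function.update u i (w i)) < 0) ∧
      ∀ v ∈ U i, (∀ m ∈ A i, g m (Function.update u i v) ≤ 0) →
        f i (Function.update u i (w i)) < f i (Function.update u i v) + δ})
    (fun u _ w hw w' hw' a b ha hb hab i ↦ by
      refine ⟨fun m hm ↦ ?_, fun v hv hvg ↦ ?_⟩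
      · exact ((hgconv m u i).convex_lt 0 ⟨Set.mem_univ _, (hw i).1 m hm⟩
          ⟨Set.mem_univ _, (hw' i).1 m hm⟩ ha hb hab).2
      · exact ((hfconv i u).convex_lt _ ⟨Set.mem_univ _, (hw i).2 v hv hvg⟩
          ⟨Set.mem_univ _, (hw' i).2 v hv hvg⟩ ha hb hab).2)
    (fun u hu ↦ by
      choose s hsU hsg hsf using fun i ↦ exists_strictly_feasible_near_optimal hUconv hUcomp
        hfcont hgcont hgconv (hSlater i u fun j ↦ hu j (Set.mem_univ j)) hδ
      refine ⟨s, fun i _ ↦ hsU i, Filter.Eventually.filter_mono nhdsWithin_le_nhds ?_⟩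
      exact Filter.eventually_all.2 fun i ↦
        eventually_strictly_feasible_near_optimal hUcomp hfcont hgcont (hsg i) (hsf i))
  refine ⟨u, fun i ↦ hu i (Set.mem_univ i), fun i ↦ ?_⟩
  simpa only [Function.update_eq_self] using hut i

end Equilibrium

/-- Existence of a generalized Nash equilibrium in a locally-aware constrained
network game on Euclidean action spaces, under convexity, compactness,
continuity and a Slater-type constraint qualification. -/
theorem gne_existence_locally_aware
    {ι : Type*} [Fintype ι] [Nonempty ι] [DecidableEq ι]
    (K : ι → ℕ)
    (U : ∀ i, Set (EuclideanSpace ℝ (Fin (K i))))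
    (hUne : ∀ i, (U i).Nonempty)
    (hUconv : ∀ i, Convex ℝ (U i))
    (hUcomp : ∀ i, IsCompact (U i))
    (f : ι → (∀ i, EuclideanSpace ℝ (Fin (K i))) → ℝ)
    (hfcont : ∀ i, Continuous (f i))
    (hfconv : ∀ i (u : ∀ j, EuclideanSpace ℝ (Fin (K j))),
      ConvexOn ℝ Set.univ (fun v => f i (Function.update u i v)))
    {M : Type*} [Fintype M]
    (g : M → (∀ i, EuclideanSpace ℝ (Fin (K i))) → ℝ)
    (hgcont : ∀ m, Continuous (g m))
    (hgconv : ∀ m (u : ∀ j, EuclideanSpace ℝ (Fin (K j))) (i : ι),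
      ConvexOn ℝ Set.univ (fun v => g m (Function.update u i v)))
    (Aw : ι → Set M)
    (𝒩 : ι → Set ι) (h𝒩 : ∀ i, i ∈ 𝒩 i)
    (A : ι → Set M) (hA : ∀ i, A i = ⋃ j ∈ 𝒩 i, Aw j)
    (hSlater : ∀ (i : ι) (u : ∀ j, EuclideanSpace ℝ (Fin (K j))),
      (∀ j, u j ∈ U j) →
      ∃ v ∈ U i, ∀ m ∈ A i, g m (Function.update u i v) < 0) :
    ∃ u : ∀ i, EuclideanSpace ℝ (Fin (K i)),
      ∀ i : ι,
        (u i ∈ U i ∧ ∀ m ∈ A i, g m u ≤ 0) ∧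
        (∀ v ∈ U i, (∀ m ∈ A i, g m (Function.update u i v) ≤ 0) →
          f i u ≤ f i (Function.update u i v)) := by
  choose u huU hug huf using fun n : ℕ ↦ exists_approximate_equilibrium hUne hUconv hUcomp hfcont
    hfconv hgcont hgconv hSlater (Nat.one_div_pos_of_nat (α := ℝ) (n := n))
  obtain ⟨x, hx, φ, hφ, hlim⟩ := (isCompact_univ_pi hUcomp).tendsto_subseq
    fun n ↦ show u n ∈ Set.pi Set.univ U from fun i _ ↦ huU n i
  have hxU : ∀ i, x i ∈ U i := fun i ↦ hx i (Set.mem_univ i)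
  refine ⟨x, fun i ↦ ⟨⟨hxU i, fun m hm ↦ ?_⟩, fun v hv hvg ↦ ?_⟩⟩
  · exact le_of_tendsto' (((hgcont m).tendsto x).comp hlim) fun n ↦ (hug _ i m hm).le
  · obtain ⟨v₀, hv₀, hlt⟩ := hSlater i x hxU
    have hupd : Continuous fun w ↦ Function.update x i w :=
      continuous_const.update i continuous_id
    refine closure_minimal (t := {w | f i x ≤ f i (Function.update x i w)}) ?_
      (isClosed_le continuous_const ((hfcont i).comp hupd))
      (mem_closure_strictly_feasible (hUconv i) (fun m ↦ hgconv m x i) hv₀ hlt hv hvg)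
    rintro w ⟨hwU, hwg⟩
    have hupdw : Continuous fun y : ∀ j, EuclideanSpace ℝ (Fin (K j)) ↦ Function.update y i w :=
      continuous_id.update i continuous_const
    have hev : ∀ᶠ n in Filter.atTop, ∀ m ∈ A i, g m (Function.update (u (φ n)) i w) < 0 := by
      rw [Filter.eventually_all_finite (Set.toFinite (A i))]
      exact fun m hm ↦ ((((hgcont m).comp hupdw).tendsto x).comp hlim).eventually_lt_const
        (hwg m hm)
    have hδ := (tendsto_one_div_add_atTop_nhds_zero_nat (𝕜 := ℝ)).comp hφ.tendsto_atTop
    have hright := ((((hfcont i).comp hupdw).tendsto x).comp hlim).add hδ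
    rw [add_zero] at hright
    refine le_of_tendsto_of_tendsto (((hfcont i).tendsto x).comp hlim) hright ?_
    filter_upwards [hev] with n hn
    exact (huf (φ n) i w hwU fun m hm ↦ (hn m hm).le).le
end

section
/- Let ι be a finite nonempty type, for each i let E i = EuclideanSpace ℝ (Fin (K i)), let S ⊆ (∀ i, E i) be a nonempty, convex and compact coupled constraint set, and for each i let f i : (∀ i, E i) → ℝ be continuous such that for every profile u the map v ↦ f i (Function.update u i v) is convex on E i. Then there exists u* ∈ S such that for every player i and every v ∈ E i with Function.update u* i v ∈ S, one has f i u* ≤ f i (Function.update u* i v); that is, the globally-aware constrained game with common feasible set S has at least one generalized Nash equilibrium. -/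
section Scarf

variable {X I L : Type*} [LinearOrder L]

/-- `B` is dominant for the family of rankings `r` if no point of `X` is ranked strictly above
some element of `B` by every `r i`. -/
def IsDominant (r : I → X → L) (B : Finset X) : Prop :=
  ∀ y, ∃ i, ∀ z ∈ B, r i y ≤ r i z

lemma IsDominant.mono {r : I → X → L} {A B : Finset X} (hB : IsDominant r B) (h : A ⊆ B) :
    IsDominant r A := fun y => (hB y).imp fun _ hi z hz => hi z (h hz)

/-- A nonempty dominant set with one element fewer than there are rankings extends to a dominant
set by one further element in exactly two ways. -/
lemma IsDominant.exists_two_extensions [Fintype X] [DecidableEq X] [Fintype I]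
    {r : I → X → L} (hr : ∀ i, Function.Injective (r i))
    {A : Finset X} (hA : IsDominant r A) (hne : A.Nonempty)
    (hcard : A.card + 1 = Fintype.card I)
    (hM : ∀ j, ∃ y, ∀ i, i ≠ j → ∃ z ∈ A, r i z < r i y) :
    ∃ x₁ x₂, x₁ ≠ x₂ ∧ ∀ x, (x ∉ A ∧ IsDominant r (insert x A)) ↔ (x = x₁ ∨ x = x₂) := by
  choose g hgA hg using fun i => A.exists_min_image (r i) hne
  classical
  have hsub : ∀ J : Finset I, A ⊆ J.image g → A.card ≤ J.card := fun J hJ =>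
    (Finset.card_le_card hJ).trans Finset.card_image_le
  have hsurj : ∀ z ∈ A, ∃ i, g i = z := fun z hz => by
    obtain ⟨i, hi⟩ := hA z
    exact ⟨i, hr i (le_antisymm (hg i z hz) (hi _ (hgA i)))⟩
  obtain ⟨a, -, b, -, hab, hgab⟩ := Finset.exists_ne_map_eq_of_card_lt_of_maps_to
    (s := Finset.univ) (t := A) (f := g) (by rw [Finset.card_univ]; omega) (fun i _ => hgA i)
  have hcover : ∀ j, j = a ∨ j = b → ∀ z ∈ A, ∃ i, i ≠ j ∧ g i = z := by
    intro j hj z hz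
    obtain ⟨i, hi⟩ := hsurj z hz
    by_cases hij : i = j
    · subst hij
      rcases hj with rfl | rfl
      · exact ⟨b, hab.symm, hgab ▸ hi⟩
      · exact ⟨a, hab, hgab ▸ hi⟩
    · exact ⟨i, hij, hi⟩
  have hM' : ∀ j, (Finset.univ.filter fun y => ∀ i, i ≠ j → r i (g i) < r i y).Nonempty := by
    intro j
    obtain ⟨y, hy⟩ := hM j
    refine ⟨y, Finset.mem_filter.2 ⟨Finset.mem_univ _, fun i hi => ?_⟩⟩
    obtain ⟨z, hz, hzy⟩ := hy i hi
    exact (hg i z hz).trans_lt hzy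
  choose x hxM hx using fun j => Finset.exists_max_image _ (r j) (hM' j)
  simp only [Finset.mem_filter, Finset.mem_univ, true_and] at hxM hx
  have hxlow : ∀ j, ∀ z ∈ A, r j (x j) ≤ r j z := by
    intro j
    obtain ⟨i, hi⟩ := hA (x j)
    by_cases hij : i = j
    · exact hij ▸ hi
    · exact absurd (hi _ (hgA i)) (hxM j i hij).not_ge
  refine ⟨x a, x b, ?_, fun y => ⟨?_, ?_⟩⟩
  · intro h
    have h1 := hxM b a hab
    have h2 := hxlow a _ (hgA a)
    rw [h] at h2
    exact h1.not_ge h2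
  · rintro ⟨hyA, hy⟩
    obtain ⟨j, hj⟩ := hy y
    have hjA : ∀ z ∈ A, r j y < r j z := fun z hz =>
      lt_of_le_of_ne (hj z (Finset.mem_insert_of_mem hz)) fun h => hyA (hr j h ▸ hz)
    have hmin : ∀ z ∈ A, ∃ i, g i = z ∧ r i z < r i y := by
      intro z hz
      obtain ⟨i, hi⟩ := hy z
      refine ⟨i, hr i (le_antisymm (hg i z hz) (hi _ (Finset.mem_insert_of_mem (hgA i)))), ?_⟩
      exact lt_of_le_of_ne (hi y (Finset.mem_insert_self _ _)) fun h => hyA (hr i h ▸ hz)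
    have hyM : ∀ i, i ≠ j → r i (g i) < r i y := by
      intro i hij
      by_contra! hle
      have := hsub (Finset.univ \ {i, j}) fun z hz => by
        obtain ⟨k, rfl, hk⟩ := hmin z hz
        refine Finset.mem_image_of_mem _ ?_
        simp only [Finset.mem_sdiff, Finset.mem_univ, true_and, Finset.mem_insert,
          Finset.mem_singleton, not_or]
        constructor
        · rintro rfl
          exact hk.not_ge hle
        · rintro rfl
          exact lt_asymm hk (hjA _ hz)
      rw [Finset.card_sdiff_of_subset (Finset.subset_univ _), Finset.card_univ,
        Finset.card_pair hij] at this
      have := hne.card_pos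
      omega
    have hyx : y = x j := by
      refine hr j (le_antisymm (hx j y hyM) ?_)
      obtain ⟨i, hi⟩ := hy (x j)
      by_cases hij : i = j
      · subst hij
        exact hi y (Finset.mem_insert_self _ _)
      · exact absurd (hi _ (Finset.mem_insert_of_mem (hgA i))) (hxM j i hij).not_ge
    have hjab : j = a ∨ j = b := by
      by_contra! h
      have h1 := hyM a h.1.symm
      have h2 := hyM b h.2.symm
      have := hsub (Finset.univ \ {a, j}) fun z hz => by
        obtain ⟨k, rfl, hk⟩ := hmin z hz
        have hkj : k ≠ j := by
          rintro rfl
          exact lt_asymm hk (hjA _ hz)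
        by_cases hka : k = a
        · subst hka
          rw [hgab]
          refine Finset.mem_image_of_mem _ ?_
          simp [hab.symm, h.2.symm]
        · refine Finset.mem_image_of_mem _ ?_
          simp [hka, hkj]
      rw [Finset.card_sdiff_of_subset (Finset.subset_univ _), Finset.card_univ,
        Finset.card_pair h.1.symm] at this
      have := hne.card_pos
      omega
    rcases hjab with rfl | rfl
    · exact Or.inl hyx
    · exact Or.inr hyx
  · intro hy
    obtain ⟨j, hj, rfl⟩ : ∃ j, (j = a ∨ j = b) ∧ y = x j := by
      rcases hy with rfl | rfl
      · exact ⟨a, Or.inl rfl, rfl⟩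
      · exact ⟨b, Or.inr rfl, rfl⟩
    refine ⟨fun hmem => ?_, fun y => ?_⟩
    · obtain ⟨i, hij, hi⟩ := hcover j hj _ hmem
      have := hxM j i hij
      rw [hi] at this
      exact lt_irrefl _ this
    · by_cases hyM : ∀ i, i ≠ j → r i (g i) < r i y
      · refine ⟨j, fun z hz => ?_⟩
        rcases Finset.mem_insert.1 hz with rfl | hz
        · exact hx j y hyM
        · obtain ⟨i, hi⟩ := hA y
          by_cases hij : i = j
          · exact hij ▸ hi z hz
          · exact absurd (hi _ (hgA i)) (hyM i hij).not_ge
      · push Not at hyM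
        obtain ⟨i, hij, hi⟩ := hyM
        refine ⟨i, fun z hz => ?_⟩
        rcases Finset.mem_insert.1 hz with rfl | hz
        · exact hi.trans (hxM j i hij).le
        · exact hi.trans (hg i z hz)

/-- In a set with as many elements as there are colours, but not using all of them, the number of
elements whose removal leaves exactly the colours other than `i₀` is even. -/
lemma even_card_filter_image_erase [DecidableEq X] [Fintype I] [DecidableEq I]
    (c : X → I) (i₀ : I) {B : Finset X}
    (hcard : B.card = Fintype.card I) (hB : B.image c ≠ Finset.univ) :
    Even (B.filter fun x => (B.erase x).image c = Finset.univ.erase i₀).card := by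
  rcases Finset.eq_empty_or_nonempty
    (B.filter fun x => (B.erase x).image c = Finset.univ.erase i₀) with h | ⟨x₀, hx₀⟩
  · simp [h]
  obtain ⟨hx₀B, hx₀⟩ := Finset.mem_filter.1 hx₀
  have hinj : Set.InjOn c (B.erase x₀) := by
    rw [← Finset.card_image_iff, hx₀, Finset.card_erase_of_mem (Finset.mem_univ _),
      Finset.card_erase_of_mem hx₀B, hcard, Finset.card_univ]
  have hc₀ : c x₀ ≠ i₀ := by
    intro h
    apply hB
    rw [← Finset.insert_erase hx₀B, Finset.image_insert, hx₀, h,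
      Finset.insert_erase (Finset.mem_univ _)]
  have : c x₀ ∈ (B.erase x₀).image c := by simp [hx₀, hc₀]
  obtain ⟨x₁, hx₁, hc₁⟩ := Finset.mem_image.1 this
  obtain ⟨hne, hx₁B⟩ := Finset.mem_erase.1 hx₁
  have hcover : ∀ x ∈ B, c x ≠ i₀ := by
    intro x hx
    by_cases h : x = x₀
    · exact h ▸ hc₀
    · have : c x ∈ (B.erase x₀).image c := Finset.mem_image_of_mem c (Finset.mem_erase.2 ⟨h, hx⟩)
      rw [hx₀] at this
      exact Finset.ne_of_mem_erase this
  have hx₁' : (B.erase x₁).image c = Finset.univ.erase i₀ := by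
    rw [← hx₀]
    ext i
    simp only [Finset.mem_image, Finset.mem_erase]
    constructor
    · rintro ⟨y, ⟨hy, hyB⟩, rfl⟩
      by_cases h : y = x₀
      · exact ⟨x₁, ⟨hne, hx₁B⟩, by rw [hc₁, h]⟩
      · exact ⟨y, ⟨h, hyB⟩, rfl⟩
    · rintro ⟨y, ⟨hy, hyB⟩, rfl⟩
      by_cases h : y = x₁
      · exact ⟨x₀, ⟨hne.symm, hx₀B⟩, by rw [← hc₁, h]⟩
      · exact ⟨y, ⟨h, hyB⟩, rfl⟩
  suffices B.filter (fun x => (B.erase x).image c = Finset.univ.erase i₀) = {x₀, x₁} by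
    rw [this, Finset.card_pair hne.symm]
    exact even_two
  ext x
  simp only [Finset.mem_filter, Finset.mem_insert, Finset.mem_singleton]
  constructor
  · rintro ⟨hxB, hx⟩
    by_contra! h
    have : c x ∈ (B.erase x).image c := by simp [hx, hcover x hxB]
    obtain ⟨y, hy, hyx⟩ := Finset.mem_image.1 this
    obtain ⟨hyne, hyB⟩ := Finset.mem_erase.1 hy
    have hxe : x ∈ B.erase x₀ := Finset.mem_erase.2 ⟨h.1, hxB⟩
    by_cases hy₀ : y = x₀
    · exact h.2 (hinj hxe hx₁ (by rw [hc₁, ← hyx, hy₀]))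
    · exact hyne (hinj (Finset.mem_erase.2 ⟨hy₀, hyB⟩) hxe hyx)
  · rintro (rfl | rfl)
    · exact ⟨hx₀B, hx₀⟩
    · exact ⟨hx₁B, hx₁'⟩

/-- **Scarf's lemma** for injective rankings: some dominant set carries every colour. -/
theorem exists_isDominant_image_eq_univ [Fintype X] [Fintype I] [DecidableEq I]
    [Nonempty I] {r : I → X → L}
    (hr : ∀ i, Function.Injective (r i))
    {s : I → X} {c : X → I} (hc : ∀ i, c (s i) = i) (hmin : ∀ i y, r i (s i) ≤ r i y)
    (hmax : ∀ t, t ∉ Set.range s → ∀ i j, i ≠ j → r i t < r i (s j)) :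
    ∃ B : Finset X, IsDominant r B ∧ B.card = Fintype.card I ∧ B.image c = Finset.univ := by
  classical
  by_contra! hcon
  obtain ⟨i₀⟩ := ‹Nonempty I›
  have hs : Function.Injective s := Function.LeftInverse.injective hc
  let doors : Finset (Finset X) := Finset.univ.filter fun A =>
    A.card + 1 = Fintype.card I ∧ A.image c = Finset.univ.erase i₀
  let rooms : Finset (Finset X) := Finset.univ.filter fun B =>
    IsDominant r B ∧ B.card = Fintype.card I
  let A₀ : Finset X := (Finset.univ.erase i₀).image s
  have hcount : ∑ A ∈ doors, (Finset.univ.filter fun x => x ∉ A ∧ IsDominant r (insert x A)).card =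
      ∑ B ∈ rooms, (B.filter fun x => (B.erase x).image c = Finset.univ.erase i₀).card := by
    rw [← Finset.card_sigma, ← Finset.card_sigma]
    refine Finset.card_nbij' (fun p => ⟨insert p.2 p.1, p.2⟩) (fun p => ⟨p.1.erase p.2, p.2⟩)
      ?_ ?_ ?_ ?_
    · rintro ⟨A, x⟩ h
      simp only [doors, rooms, Finset.coe_sigma, Set.mem_sigma_iff, Finset.coe_filter,
        Finset.mem_univ, true_and, Set.mem_ofPred_eq] at h ⊢
      obtain ⟨⟨h1, h2⟩, h3, h4⟩ := h
      refine ⟨⟨h4, by rw [Finset.card_insert_of_notMem h3, h1]⟩, Finset.mem_insert_self _ _, ?_⟩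
      rw [Finset.erase_insert h3, h2]
    · rintro ⟨B, x⟩ h
      simp only [doors, rooms, Finset.coe_sigma, Set.mem_sigma_iff, Finset.coe_filter,
        Finset.mem_univ, true_and, Set.mem_ofPred_eq] at h ⊢
      obtain ⟨⟨h1, h2⟩, h3, h4⟩ := h
      refine ⟨⟨by rw [Finset.card_erase_add_one h3, h2], h4⟩, Finset.notMem_erase _ _, ?_⟩
      rwa [Finset.insert_erase h3]
    · rintro ⟨A, x⟩ h
      simp only [Finset.coe_sigma, Set.mem_sigma_iff, Finset.coe_filter, Finset.mem_univ, true_and,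
        Set.mem_ofPred_eq] at h
      simp [Finset.erase_insert h.2.1]
    · rintro ⟨B, x⟩ h
      simp only [Finset.coe_sigma, Set.mem_sigma_iff, Finset.coe_filter, Set.mem_ofPred_eq] at h
      simp [Finset.insert_erase h.2.1]
  have heven : Even (∑ B ∈ rooms,
      (B.filter fun x => (B.erase x).image c = Finset.univ.erase i₀).card) := by
    refine Finset.even_sum _ fun B hB => ?_
    obtain ⟨h1, h2⟩ := (Finset.mem_filter.1 hB).2
    exact even_card_filter_image_erase c i₀ h2 (hcon B h1 h2)
  have hA₀ : A₀ ∈ doors := by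
    refine Finset.mem_filter.2 ⟨Finset.mem_univ _, ?_, ?_⟩
    · rw [Finset.card_image_of_injective _ hs, Finset.card_erase_add_one (Finset.mem_univ _),
        Finset.card_univ]
    · ext i
      simp [A₀, hc]
  have hmem₀ : ∀ i, i ≠ i₀ → s i ∈ A₀ := fun i hi => by simp [A₀, hs.eq_iff, hi]
  have hone : (Finset.univ.filter fun x => x ∉ A₀ ∧ IsDominant r (insert x A₀)).card = 1 := by
    have hne : (Finset.univ \ A₀).Nonempty := ⟨s i₀, by simp [A₀, hs.eq_iff]⟩
    obtain ⟨x, hxA, hx⟩ := Finset.exists_max_image _ (r i₀) hne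
    simp only [Finset.mem_sdiff, Finset.mem_univ, true_and] at hxA hx
    refine Finset.card_eq_one.2 ⟨x, ?_⟩
    ext y
    simp only [Finset.mem_filter, Finset.mem_univ, true_and, Finset.mem_singleton]
    constructor
    · rintro ⟨hyA, hy⟩
      refine hr i₀ (le_antisymm (hx y hyA) ?_)
      obtain ⟨i, hi⟩ := hy x
      by_cases h : i = i₀
      · subst h
        exact hi y (Finset.mem_insert_self _ _)
      · have := hr i (le_antisymm (hi _ (Finset.mem_insert_of_mem (hmem₀ i h))) (hmin i x))
        exact absurd (this ▸ hmem₀ i h) hxA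
    · rintro rfl
      refine ⟨hxA, fun z => ?_⟩
      by_cases hz : ∃ i, s i = z
      · obtain ⟨i, rfl⟩ := hz
        exact ⟨i, fun w _ => hmin i w⟩
      · refine ⟨i₀, fun w hw => ?_⟩
        rcases Finset.mem_insert.1 hw with rfl | hw
        · refine hx z fun hzA => hz ?_
          obtain ⟨i, -, hi⟩ := Finset.mem_image.1 hzA
          exact ⟨i, hi⟩
        · obtain ⟨i, hi, rfl⟩ := Finset.mem_image.1 hw
          exact (hmax z hz i₀ i (Finset.ne_of_mem_erase hi).symm).le
  have htwo : Even (∑ A ∈ doors.erase A₀,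
      (Finset.univ.filter fun x => x ∉ A ∧ IsDominant r (insert x A)).card) := by
    refine Finset.even_sum _ fun A hA => ?_
    obtain ⟨hAne, hA⟩ := Finset.mem_erase.1 hA
    obtain ⟨h1, h2⟩ := (Finset.mem_filter.1 hA).2
    obtain ⟨t, htA, ht⟩ : ∃ t ∈ A, t ∉ Set.range s := by
      by_contra! h
      refine hAne (Finset.eq_of_subset_of_card_le (fun z hz => ?_) ?_)
      · obtain ⟨i, rfl⟩ := h z hz
        refine hmem₀ i fun hi => ?_
        have := Finset.mem_image_of_mem c hz
        simp [h2, hc, hi] at this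
      · have := (Finset.mem_filter.1 hA₀).2.1
        omega
    rcases Finset.eq_empty_or_nonempty
      (Finset.univ.filter fun x => x ∉ A ∧ IsDominant r (insert x A)) with h | ⟨x, hx⟩
    · simp [h]
    have hdom : IsDominant r A := ((Finset.mem_filter.1 hx).2.2).mono (Finset.subset_insert _ _)
    obtain ⟨x₁, x₂, hne, hx⟩ := hdom.exists_two_extensions hr ⟨t, htA⟩ h1
      fun j => ⟨s j, fun i hij => ⟨t, htA, hmax t ht i j hij⟩⟩
    have : (Finset.univ.filter fun x => x ∉ A ∧ IsDominant r (insert x A)) = {x₁, x₂} := by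
      ext x
      simp [hx]
    rw [this, Finset.card_pair hne]
    exact even_two
  rw [← hcount, ← Finset.add_sum_erase _ _ hA₀, hone, Nat.even_add] at heven
  exact absurd (heven.2 htwo) (by decide)

end Scarf

/-- A colouring of the lattice points of a dilated simplex has a lattice point each of whose
coordinates is small or whose colour occurs nearby. -/
theorem exists_lattice_point_near_colours {I : Type*} [Fintype I] [Nonempty I]
    (N : ℕ) (c : (I → ℕ) → I) :
    ∃ x₀ : I → ℕ, ∑ i, x₀ i = N ∧ ∀ i, x₀ i ≤ Fintype.card I ∨
      ∃ x : I → ℕ, ∑ j, x j = N ∧ c x = i ∧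
        ∀ j, x j ≤ x₀ j + Fintype.card I ∧ x₀ j ≤ x j + Fintype.card I := by
  classical
  let T := ↥(Finset.piAntidiag (Finset.univ : Finset I) N)
  have hT : ∀ x : T, ∑ i, x.1 i = N := fun x => (Finset.mem_piAntidiag.1 x.2).1
  have hTle : ∀ (x : T) i, x.1 i ≤ N := fun x i =>
    (Finset.single_le_sum (fun _ _ => Nat.zero_le _) (Finset.mem_univ i)).trans (hT x).le
  have mkT : ∀ y : I → ℕ, ∑ i, y i = N → ∃ x : T, x.1 = y := fun y hy =>
    ⟨⟨y, Finset.mem_piAntidiag.2 ⟨hy, fun _ _ => Finset.mem_univ _⟩⟩, rfl⟩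
  let v : I → T ⊕ I → ℤ := fun i =>
    Sum.elim (fun x => (x.1 i : ℤ)) fun j => if j = i then -1 else N + 1
  let r : I → T ⊕ I → ℤ ×ₗ Fin (Fintype.card (T ⊕ I)) := fun i z =>
    toLex (v i z, Fintype.equivFin (T ⊕ I) z)
  have hv : ∀ i z w, r i z ≤ r i w → v i z ≤ v i w := fun i z w h => by
    rcases Prod.Lex.le_iff.1 h with h | h
    · exact h.le
    · exact h.1.le
  have hlt : ∀ i z w, v i z < v i w → r i z < r i w := fun i z w h =>
    Prod.Lex.lt_iff.2 (Or.inl h)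
  obtain ⟨B, hdom, -, hcol⟩ := exists_isDominant_image_eq_univ (r := r) (s := Sum.inr)
    (c := Sum.elim (fun x => c x.1) id)
    (fun i z w h => (Fintype.equivFin (T ⊕ I)).injective
      (congrArg Prod.snd (toLex.injective h)))
    (fun i => rfl)
    (by
      rintro i (x | j)
      · refine (hlt _ _ _ ?_).le
        simp only [v, Sum.elim_inl, Sum.elim_inr, if_true]
        omega
      · by_cases h : j = i
        · rw [h]
        · refine (hlt _ _ _ ?_).le
          simp only [v, Sum.elim_inr, if_true, if_neg h]
          omega)
    (by
      rintro (x | k) hx i j hij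
      · refine hlt _ _ _ ?_
        have := hTle x i
        simp only [v, Sum.elim_inl, Sum.elim_inr, if_neg hij.symm]
        omega
      · exact absurd ⟨k, rfl⟩ hx)
  have hcolour : ∀ i, ∃ z ∈ B, Sum.elim (fun x : T => c x.1) id z = i := fun i =>
    Finset.mem_image.1 (by rw [hcol]; exact Finset.mem_univ i)
  let C : Finset I := Finset.univ.filter fun i => Sum.inr i ∉ B
  have hdomC : ∀ y : T, ∃ i ∈ C, ∀ x : T, Sum.inl x ∈ B → y.1 i ≤ x.1 i := by
    intro y
    obtain ⟨i, hi⟩ := hdom (Sum.inl y)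
    refine ⟨i, Finset.mem_filter.2 ⟨Finset.mem_univ _, fun hiB => ?_⟩, fun x hx => ?_⟩
    · have := hv _ _ _ (hi _ hiB)
      simp only [v, Sum.elim_inl, Sum.elim_inr, if_true] at this
      omega
    · simpa [v] using hv _ _ _ (hi _ hx)
  have hCne : C.Nonempty := by
    obtain ⟨x, -⟩ := mkT (Pi.single (Classical.arbitrary I) N) (by simp)
    obtain ⟨i, hi, -⟩ := hdomC x
    exact ⟨i, hi⟩
  have hσ : ∃ x : T, Sum.inl x ∈ B := by
    by_contra! h
    obtain ⟨i, hi⟩ := hCne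
    obtain ⟨x | j, hz, hzi⟩ := hcolour i
    · exact h x hz
    · obtain rfl : j = i := hzi
      exact (Finset.mem_filter.1 hi).2 hz
  obtain ⟨x₀, hx₀⟩ := hσ
  have hm : ∀ i, ∃ w : T, Sum.inl w ∈ B ∧ ∀ x : T, Sum.inl x ∈ B → w.1 i ≤ x.1 i := by
    intro i
    obtain ⟨w, hw, hmin⟩ := (Finset.univ.filter fun x : T => Sum.inl x ∈ B).exists_min_image
      (fun x => x.1 i) ⟨x₀, by simpa using hx₀⟩
    exact ⟨w, by simpa using hw, fun x hx => hmin x (by simpa using hx)⟩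
  choose w hwB hw using hm
  let m : I → ℕ := fun i => if i ∈ C then (w i).1 i else 0
  have hmle : ∀ x : T, Sum.inl x ∈ B → ∀ i, m i ≤ x.1 i := by
    intro x hx i
    by_cases h : i ∈ C
    · simpa [m, h] using hw i x hx
    · simp [m, h]
  have hsum : N < ∑ i, (m i + 1) := by
    by_contra! hle
    obtain ⟨i₁, -⟩ := hCne
    obtain ⟨y, hy⟩ := mkT
      (fun i => (m i + 1) + (Pi.single i₁ (N - ∑ i, (m i + 1)) : I → ℕ) i) (by
        rw [Finset.sum_add_distrib, Finset.sum_pi_single' i₁]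
        simp only [Finset.mem_univ, if_true]
        omega)
    obtain ⟨i, hi, h⟩ := hdomC y
    have := h _ (hwB i)
    rw [hy] at this
    simp only [m, if_pos hi] at this
    omega
  have hbound : ∀ x : T, Sum.inl x ∈ B → ∀ i, x.1 i ≤ m i + Fintype.card I := by
    intro x hx i
    have h1 : x.1 i + ∑ j ∈ Finset.univ.erase i, x.1 j = N := by
      rw [Finset.add_sum_erase _ _ (Finset.mem_univ i), hT]
    have h2 : m i + ∑ j ∈ Finset.univ.erase i, m j = ∑ j, m j :=
      Finset.add_sum_erase _ _ (Finset.mem_univ i)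
    have h3 : ∑ j ∈ Finset.univ.erase i, m j ≤ ∑ j ∈ Finset.univ.erase i, x.1 j :=
      Finset.sum_le_sum fun j _ => hmle x hx j
    rw [Finset.sum_add_distrib, Finset.sum_const, Finset.card_univ, smul_eq_mul] at hsum
    omega
  refine ⟨x₀.1, hT x₀, fun i => ?_⟩
  obtain ⟨x | j, hz, hzi⟩ := hcolour i
  · refine Or.inr ⟨x.1, hT x, hzi, fun j => ?_⟩
    have := hmle x hz j
    have := hmle x₀ hx₀ j
    have := hbound x hz j
    have := hbound x₀ hx₀ j
    omega
  · obtain rfl : j = i := hzi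
    have := hbound x₀ hx₀ j
    rw [show m j = 0 from if_neg fun h : j ∈ C => (Finset.mem_filter.1 h).2 hz] at this
    exact Or.inl (by omega)

/-- A covering theorem for the simplex, equivalent to Brouwer's fixed point theorem: if closed sets
`{φ i ≤ 0}` cover the simplex and the `i`-th one contains the facet `p i = 0` in the quantitative
sense `φ i p ≤ p i`, then they have a common point. -/
theorem exists_mem_stdSimplex_forall_nonpos {I : Type*} [Fintype I] [Nonempty I]
    (φ : I → (I → ℝ) → ℝ) (hφ : ∀ i, ContinuousOn (φ i) (stdSimplex ℝ I))
    (hle : ∀ i, ∀ p ∈ stdSimplex ℝ I, φ i p ≤ p i)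
    (hcov : ∀ p ∈ stdSimplex ℝ I, ∃ i, φ i p ≤ 0) :
    ∃ p ∈ stdSimplex ℝ I, ∀ i, φ i p ≤ 0 := by
  classical
  have hK : IsCompact (stdSimplex ℝ I) := isCompact_stdSimplex ℝ I
  have happrox : ∀ ε > 0, ∃ p ∈ stdSimplex ℝ I, ∀ i, φ i p ≤ ε := by
    intro ε hε
    have huc : ∀ i, ∃ δ > 0, ∀ p ∈ stdSimplex ℝ I, ∀ q ∈ stdSimplex ℝ I,
        dist p q < δ → dist (φ i p) (φ i q) < ε := fun i =>
      Metric.uniformContinuousOn_iff.1 (hK.uniformContinuousOn_of_continuous (hφ i)) ε hε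
    choose δ hδ hδφ using huc
    obtain ⟨i₁, -, hi₁⟩ := Finset.univ.exists_min_image δ Finset.univ_nonempty
    set n := Fintype.card I
    obtain ⟨N, hN⟩ := exists_nat_gt (max (n / ε) (n / δ i₁))
    have hn : (0 : ℝ) ≤ n := Nat.cast_nonneg _
    have hN0 : (0 : ℝ) < N := ((div_nonneg hn hε.le).trans (le_max_left _ _)).trans_lt hN
    have hNε : (n : ℝ) / N < ε := by
      have := (le_max_left _ _).trans_lt hN
      rw [div_lt_iff₀ hε] at this
      rw [div_lt_iff₀ hN0]
      linarith
    have hNδ : (n : ℝ) / N < δ i₁ := by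
      have := (le_max_right _ _).trans_lt hN
      rw [div_lt_iff₀ (hδ i₁)] at this
      rw [div_lt_iff₀ hN0]
      linarith
    have hmem : ∀ x : I → ℕ, ∑ i, x i = N → (fun i => (x i : ℝ) / N) ∈ stdSimplex ℝ I := by
      intro x hx
      refine ⟨fun i => by positivity, ?_⟩
      rw [← Finset.sum_div, ← Nat.cast_sum, hx, div_self hN0.ne']
    have hc : ∀ x : I → ℕ, ∃ i, ∑ j, x j = N → φ i (fun i => (x i : ℝ) / N) ≤ 0 := by
      intro x
      by_cases hx : ∑ j, x j = N
      · exact (hcov _ (hmem x hx)).imp fun _ h _ => h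
      · exact ⟨Classical.arbitrary I, fun h => absurd h hx⟩
    choose c hc using hc
    obtain ⟨x₀, hx₀, h⟩ := exists_lattice_point_near_colours N c
    refine ⟨_, hmem x₀ hx₀, fun i => ?_⟩
    rcases h i with h | ⟨x, hx, rfl, hxx⟩
    · refine (hle i _ (hmem x₀ hx₀)).trans (le_trans ?_ hNε.le)
      have : (x₀ i : ℝ) ≤ n := by exact_mod_cast h
      gcongr
    · have hd : dist (fun i => (x₀ i : ℝ) / N) (fun i => (x i : ℝ) / N) < δ (c x) := by
        refine lt_of_le_of_lt ((dist_pi_le_iff (by positivity)).2 fun j => ?_)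
          (hNδ.trans_le (hi₁ (c x) (Finset.mem_univ _)))
        have h1 : (x j : ℝ) ≤ x₀ j + n := by exact_mod_cast (hxx j).1
        have h2 : (x₀ j : ℝ) ≤ x j + n := by exact_mod_cast (hxx j).2
        rw [Real.dist_eq, ← sub_div, abs_div, abs_of_pos hN0]
        gcongr
        rw [abs_le]
        constructor <;> linarith
      have := hδφ (c x) _ (hmem x₀ hx₀) _ (hmem x hx) hd
      rw [Real.dist_eq, abs_lt] at this
      linarith [hc x hx]
  have hne : (stdSimplex ℝ I).Nonempty := (happrox 1 one_pos).imp fun _ h => h.1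
  obtain ⟨p, hp, hmin⟩ := hK.exists_isMinOn hne
    (f := fun p => Finset.univ.sup' Finset.univ_nonempty fun i => φ i p)
    (ContinuousOn.finset_sup'_apply _ fun i _ => hφ i)
  refine ⟨p, hp, fun i => le_of_forall_pos_le_add fun ε hε => ?_⟩
  obtain ⟨q, hq, hqε⟩ := happrox ε hε
  calc φ i p ≤ Finset.univ.sup' Finset.univ_nonempty fun i => φ i p :=
        Finset.le_sup' (fun i => φ i p) (Finset.mem_univ i)
    _ ≤ Finset.univ.sup' Finset.univ_nonempty fun i => φ i q := hmin hq
    _ ≤ 0 + ε := Finset.sup'_le _ _ fun i _ => by simpa using hqε i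

/-- **Ky Fan's inequality** for a bifunction vanishing on the diagonal, continuous in the first
variable and convex in the second. -/
theorem exists_forall_nonneg_of_convexOn {E : Type*} [AddCommGroup E] [Module ℝ E]
    [TopologicalSpace E] [ContinuousAdd E] [ContinuousSMul ℝ E] {S : Set E} (hne : S.Nonempty)
    (hconv : Convex ℝ S) (hcomp : IsCompact S) {Φ : E → E → ℝ} (hdiag : ∀ u, Φ u u = 0)
    (hcont : ∀ v, Continuous fun u => Φ u v) (hΦ : ∀ u, ConvexOn ℝ S (Φ u)) :
    ∃ u ∈ S, ∀ v ∈ S, 0 ≤ Φ u v := by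
  suffices (S ∩ ⋂ v : S, {u | 0 ≤ Φ u v}).Nonempty by
    obtain ⟨u, hu, h⟩ := this
    exact ⟨u, hu, fun v hv => Set.mem_iInter.1 h ⟨v, hv⟩⟩
  refine hcomp.inter_iInter_nonempty _
    (fun v => isClosed_le continuous_const (hcont v)) fun t => ?_
  rcases t.eq_empty_or_nonempty with rfl | htne
  · simpa using hne
  have : Nonempty t := htne.to_subtype
  let u : (t → ℝ) → E := fun p => ∑ k : t, p k • (k.1 : E)
  have hu : Continuous u := by fun_prop
  have huS : ∀ p ∈ stdSimplex ℝ t, u p ∈ S := fun p hp =>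
    hconv.sum_mem (fun k _ => hp.1 k) hp.2 fun k _ => k.1.2
  let g : t → (t → ℝ) → ℝ := fun k p => max 0 (-Φ (u p) k.1)
  have hg : ∀ k, Continuous (g k) := fun k =>
    continuous_const.max ((hcont _).comp hu).neg
  have hg0 : ∀ k p, 0 ≤ g k p := fun k p => le_max_left _ _
  have hG0 : ∀ p, 0 ≤ ∑ k, g k p := fun p => Finset.sum_nonneg fun k _ => hg0 k p
  have hG1 : ∀ p, 0 < 1 + ∑ k, g k p := fun p => by linarith [hG0 p]
  obtain ⟨p, hp, h⟩ := exists_mem_stdSimplex_forall_nonpos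
    (fun k p => (p k * ∑ l, g l p - g k p) / (1 + ∑ l, g l p))
    (fun k => by
      refine Continuous.continuousOn (Continuous.div ?_ ?_ fun p => (hG1 p).ne') <;> fun_prop)
    (fun k p hp => by
      rw [div_le_iff₀ (hG1 p)]
      linarith [hp.1 k, hg0 k p])
    (fun p hp => by
      by_contra! hcon
      have hpos : 0 < ∑ k, (p k * ∑ l, g l p - g k p) :=
        Finset.sum_pos (fun k _ => (div_pos_iff_of_pos_right (hG1 p)).1 (hcon k))
          Finset.univ_nonempty
      rw [Finset.sum_sub_distrib, ← Finset.sum_mul, hp.2] at hpos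
      linarith)
  have hle : ∀ k, p k * ∑ l, g l p ≤ g k p := fun k => by
    have := h k
    rw [div_le_iff₀ (hG1 p)] at this
    linarith
  have hG : ∑ l, g l p = 0 := by
    by_contra hG
    have hGpos : 0 < ∑ l, g l p := lt_of_le_of_ne (hG0 p) (Ne.symm hG)
    have hneg : ∀ k, 0 < p k → Φ (u p) k.1 < 0 := fun k hk => by
      have : 0 < g k p := (mul_pos hk hGpos).trans_le (hle k)
      rcases lt_max_iff.1 this with h | h
      · exact absurd h (lt_irrefl _)
      · linarith
    have hJ : Φ (u p) (u p) ≤ ∑ k : t, p k • Φ (u p) k.1 :=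
      (hΦ (u p)).map_sum_le (fun k _ => hp.1 k) hp.2 fun k _ => k.1.2
    obtain ⟨k, -, hk⟩ : ∃ k ∈ Finset.univ, 0 < p k :=
      by
      refine Finset.exists_lt_of_sum_lt ?_
      rw [hp.2, Finset.sum_const_zero]
      exact one_pos
    have : ∑ k : t, p k • Φ (u p) k.1 < ∑ _k : t, (0 : ℝ) := by
      refine Finset.sum_lt_sum (fun l _ => ?_) ⟨k, Finset.mem_univ k, ?_⟩
      · rcases (hp.1 l).eq_or_lt with h | h
        · simp [← h]
        · exact (mul_neg_of_pos_of_neg h (hneg l h)).le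
      · exact mul_neg_of_pos_of_neg hk (hneg k hk)
    rw [hdiag, Finset.sum_const_zero] at *
    linarith
  refine ⟨u p, huS p hp, Set.mem_iInter₂.2 fun k hk => ?_⟩
  have := (Finset.sum_eq_zero_iff_of_nonneg fun k _ => hg0 k p).1 hG ⟨k, hk⟩ (Finset.mem_univ _)
  have := le_max_right 0 (-Φ (u p) k)
  simp only [g] at *
  simp only [Set.mem_ofPred_eq]
  linarith

/-- Existence of a generalized Nash equilibrium in a globally-aware constrained
game with a common nonempty, convex, compact coupled feasible set `S`. -/
theorem gne_existence_globally_aware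
    {ι : Type*} [Fintype ι] [Nonempty ι] [DecidableEq ι]
    (K : ι → ℕ)
    (S : Set (∀ i, EuclideanSpace ℝ (Fin (K i))))
    (hSne : S.Nonempty)
    (hSconv : Convex ℝ S)
    (hScomp : IsCompact S)
    (f : ι → (∀ i, EuclideanSpace ℝ (Fin (K i))) → ℝ)
    (hfcont : ∀ i, Continuous (f i))
    (hfconv : ∀ i (u : ∀ j, EuclideanSpace ℝ (Fin (K j))),
      ConvexOn ℝ Set.univ (fun v => f i (Function.update u i v))) :
    ∃ u ∈ S, ∀ (i : ι) (v : EuclideanSpace ℝ (Fin (K i))),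
      Function.update u i v ∈ S → f i u ≤ f i (Function.update u i v) := by
  let Φ : (∀ i, EuclideanSpace ℝ (Fin (K i))) → (∀ i, EuclideanSpace ℝ (Fin (K i))) → ℝ :=
    fun u v => ∑ i, (f i (Function.update u i (v i)) - f i u)
  obtain ⟨u, hu, h⟩ := exists_forall_nonneg_of_convexOn hSne hSconv hScomp (Φ := Φ)
    (fun u => by simp [Φ])
    (fun v => continuous_finsetSum _ fun i _ =>
      ((hfcont i).comp (continuous_id.update i continuous_const)).sub (hfcont i))
    (fun u => by
      refine ⟨hSconv, fun x _ y _ a b ha hb hab => ?_⟩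
      simp only [Φ, smul_eq_mul, Finset.mul_sum, ← Finset.sum_add_distrib]
      refine Finset.sum_le_sum fun i _ => ?_
      have h1 := (hfconv i u).2 (Set.mem_univ (x i)) (Set.mem_univ (y i)) ha hb hab
      simp only [smul_eq_mul] at h1
      have h2 : f i u = a * f i u + b * f i u := by rw [← add_mul, hab, one_mul]
      simp only [Pi.add_apply, Pi.smul_apply]
      linarith)
  refine ⟨u, hu, fun i v hv => ?_⟩
  have h0 := h _ hv
  have hsum : Φ u (Function.update u i v) = f i (Function.update u i v) - f i u := by
    refine (Finset.sum_eq_single i (fun j _ hj => ?_) (by simp)).trans ?_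
    · simp [Function.update_of_ne hj]
    · simp
  linarith
end

section
/- Consider a locally-aware constrained network game and a second game with the same players, action sets, costs, constraint functions and awareness sets, but with larger neighbor sets: 𝒩 i ⊆ 𝒩' i for every i (both containing i). Then every generalized Nash equilibrium of the game with neighbor sets 𝒩 is also a generalized Nash equilibrium of the game with neighbor sets 𝒩'; that is, as the connectivity of the network increases, the set of GNEs becomes larger (with respect to inclusion). -/
/-- Monotonicity of the set of generalized Nash equilibria in the network
connectivity: a GNE of the locally-aware game with neighbor sets `𝒩` is also a
GNE of the game with larger neighbor sets `𝒩'`. -/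
theorem gne_monotone_in_connectivity
    {ι : Type*} [Fintype ι] [Nonempty ι] [DecidableEq ι]
    {E : ι → Type*}
    (U : ∀ i, Set (E i))
    (hUne : ∀ i, (U i).Nonempty)
    (f : ι → (∀ i, E i) → ℝ)
    {M : Type*} [Fintype M]
    (g : M → (∀ i, E i) → ℝ)
    (Aw : ι → Set M)
    (𝒩 𝒩' : ι → Set ι)
    (h𝒩 : ∀ i, i ∈ 𝒩 i) (h𝒩' : ∀ i, i ∈ 𝒩' i)
    (hsub : ∀ i, 𝒩 i ⊆ 𝒩' i)
    (A A' : ι → Set M)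
    (hA : ∀ i, A i = ⋃ j ∈ 𝒩 i, Aw j)
    (hA' : ∀ i, A' i = ⋃ j ∈ 𝒩' i, Aw j)
    (u : ∀ i, E i)
    (hGNE : ∀ i : ι,
      (u i ∈ U i ∧ ∀ m ∈ A i, g m u ≤ 0) ∧
      (∀ v ∈ U i, (∀ m ∈ A i, g m (Function.update u i v) ≤ 0) →
        f i u ≤ f i (Function.update u i v))) :
    ∀ i : ι,
      (u i ∈ U i ∧ ∀ m ∈ A' i, g m u ≤ 0) ∧
      (∀ v ∈ U i, (∀ m ∈ A' i, g m (Function.update u i v) ≤ 0) →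
        f i u ≤ f i (Function.update u i v)) := by
  intro i
  obtain ⟨⟨hU, -⟩, hmin⟩ := hGNE i
  have hAA' : A i ⊆ A' i := by
    rw [hA, hA']
    exact Set.biUnion_subset_biUnion_left (hsub i)
  refine ⟨⟨hU, fun m hm => ?_⟩, fun v hv hfeas => hmin v hv fun m hm => hfeas m (hAA' hm)⟩
  rw [hA'] at hm
  obtain ⟨j, -, hmj⟩ := Set.mem_iUnion₂.mp hm
  -- player `j` is aware of `m`, so feasibility of `u` for `j` already gives the bound
  refine (hGNE j).1.2 m ?_
  rw [hA]
  exact Set.mem_biUnion (h𝒩 j) hmj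
end

section
/- Every generalized Nash equilibrium of a locally-aware constrained network game is also a generalized Nash equilibrium of the corresponding globally-aware game, i.e., of the game obtained by replacing each player's known constraint set A i = ⋃_{j ∈ 𝒩 i} Ã j with the full union Ā = ⋃_{j ∈ ι} Ã j of all players' awareness sets. -/
/-- A generalized Nash equilibrium of a locally-aware constrained network game
is also a GNE of the corresponding globally-aware game, obtained by replacing
each known constraint set `A i = ⋃ j ∈ 𝒩 i, Aw j` by `Ā = ⋃ j, Aw j`. -/
theorem gne_local_is_gne_global
    {ι : Type*} [Fintype ι] [Nonempty ι] [DecidableEq ι]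
    {E : ι → Type*}
    (U : ∀ i, Set (E i))
    (hUne : ∀ i, (U i).Nonempty)
    (f : ι → (∀ i, E i) → ℝ)
    {M : Type*} [Fintype M]
    (g : M → (∀ i, E i) → ℝ)
    (Aw : ι → Set M)
    (𝒩 : ι → Set ι) (h𝒩 : ∀ i, i ∈ 𝒩 i)
    (A : ι → Set M) (hA : ∀ i, A i = ⋃ j ∈ 𝒩 i, Aw j)
    (Abar : Set M) (hAbar : Abar = ⋃ j : ι, Aw j)
    (u : ∀ i, E i)
    (hGNE : ∀ i : ι,
      (u i ∈ U i ∧ ∀ m ∈ A i, g m u ≤ 0) ∧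
      (∀ v ∈ U i, (∀ m ∈ A i, g m (Function.update u i v) ≤ 0) →
        f i u ≤ f i (Function.update u i v))) :
    ∀ i : ι,
      (u i ∈ U i ∧ ∀ m ∈ Abar, g m u ≤ 0) ∧
      (∀ v ∈ U i, (∀ m ∈ Abar, g m (Function.update u i v) ≤ 0) →
        f i u ≤ f i (Function.update u i v)) := by
  subst hAbar
  have hsub : ∀ i, A i ⊆ ⋃ j, Aw j := fun i => by
    rw [hA i]
    exact Set.iUnion₂_subset_iUnion _ _
  refine fun i => ⟨⟨(hGNE i).1.1, fun m hm => ?_⟩, fun v hv hfeas =>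
    (hGNE i).2 v hv fun m hm => hfeas m (hsub i hm)⟩
  obtain ⟨j, hj⟩ := Set.mem_iUnion.mp hm
  refine (hGNE j).1.2 m ?_
  rw [hA j]
  exact Set.mem_biUnion (h𝒩 j) hj
end

section
/- Suppose a locally-aware constrained network game has at least one generalized Nash equilibrium, and suppose the corresponding globally-aware game (with every player's known constraint set replaced by Ā = ⋃_{j ∈ ι} Ã j) has a unique generalized Nash equilibrium ū. Then the locally-aware game also has a unique generalized Nash equilibrium, and it equals ū. -/
/-- If the locally-aware game has at least one GNE and the corresponding
globally-aware game has a unique GNE `ubar`, then the locally-aware game has a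
unique GNE, and it equals `ubar`. -/
theorem gne_local_unique_of_global_unique
    {ι : Type*} [Fintype ι] [Nonempty ι] [DecidableEq ι]
    {E : ι → Type*}
    (U : ∀ i, Set (E i))
    (hUne : ∀ i, (U i).Nonempty)
    (f : ι → (∀ i, E i) → ℝ)
    {M : Type*} [Fintype M]
    (g : M → (∀ i, E i) → ℝ)
    (Aw : ι → Set M)
    (𝒩 : ι → Set ι) (h𝒩 : ∀ i, i ∈ 𝒩 i)
    (A : ι → Set M) (hA : ∀ i, A i = ⋃ j ∈ 𝒩 i, Aw j)
    (Abar : Set M) (hAbar : Abar = ⋃ j : ι, Aw j)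
    -- predicate: `u` is a GNE of the locally-aware game
    (GNEloc : (∀ i, E i) → Prop)
    (hGNEloc : ∀ u, GNEloc u ↔ ∀ i : ι,
      (u i ∈ U i ∧ ∀ m ∈ A i, g m u ≤ 0) ∧
      (∀ v ∈ U i, (∀ m ∈ A i, g m (Function.update u i v) ≤ 0) →
        f i u ≤ f i (Function.update u i v)))
    -- predicate: `u` is a GNE of the globally-aware game
    (GNEglob : (∀ i, E i) → Prop)
    (hGNEglob : ∀ u, GNEglob u ↔ ∀ i : ι,
      (u i ∈ U i ∧ ∀ m ∈ Abar, g m u ≤ 0) ∧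
      (∀ v ∈ U i, (∀ m ∈ Abar, g m (Function.update u i v) ≤ 0) →
        f i u ≤ f i (Function.update u i v)))
    (hexists : ∃ u, GNEloc u)
    (ubar : ∀ i, E i)
    (hunique : GNEglob ubar ∧ ∀ u, GNEglob u → u = ubar) :
    GNEloc ubar ∧ ∀ u, GNEloc u → u = ubar := by
  have mem_Abar : ∀ {i m}, m ∈ A i → m ∈ Abar := by
    intro i m hm
    rw [hA] at hm
    obtain ⟨j, -, hj⟩ := Set.mem_iUnion₂.mp hm
    rw [hAbar]
    exact Set.mem_iUnion.mpr ⟨j, hj⟩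
  have glob_of_loc : ∀ u, GNEloc u → GNEglob u := by
    intro u hu
    rw [hGNEloc] at hu
    rw [hGNEglob]
    refine fun i => ⟨⟨(hu i).1.1, fun m hm => ?_⟩, fun v hv hvg =>
      (hu i).2 v hv fun m hm => hvg m (mem_Abar hm)⟩
    rw [hAbar] at hm
    obtain ⟨j, hj⟩ := Set.mem_iUnion.mp hm
    refine (hu j).1.2 m ?_
    rw [hA]
    exact Set.mem_iUnion₂.mpr ⟨j, h𝒩 j, hj⟩
  have eq_ubar : ∀ u, GNEloc u → u = ubar := fun u hu => hunique.2 u (glob_of_loc u hu)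
  obtain ⟨u, hu⟩ := hexists
  exact ⟨eq_ubar u hu ▸ hu, eq_ubar⟩
end

section
/- Let ι be a finite nonempty type, for each i let E i = EuclideanSpace ℝ (Fin (K i)) with U i ⊆ E i, and let S = {u ∈ ∀ i, E i : (∀ i, u i ∈ U i) ∧ ∀ m ∈ M, g m u ≤ 0} be the global feasible set. Assume that for every player i and every profile u the map F_{i,u} : v ↦ f i (Function.update u i v) is differentiable and convex on E i. If u* ∈ S satisfies the variational inequality Σ_{i} (fderiv ℝ (F_{i,u*}) (u* i)) (u i − u* i) ≥ 0 for every u ∈ S, then u* is a generalized Nash equilibrium of the globally-aware game: for every i and every v with Function.update u* i v ∈ S, f i u* ≤ f i (Function.update u* i v). -/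
/-- The gradient inequality: a convex function lies above its tangent at every point of
differentiability. -/
theorem ConvexOn.add_hasFDerivAt_le {E : Type*} [NormedAddCommGroup E] [NormedSpace ℝ E]
    {s : Set E} {φ : E → ℝ} {φ' : E →L[ℝ] ℝ} {x y : E} (hφ : ConvexOn ℝ s φ)
    (hx : x ∈ s) (hy : y ∈ s) (hφ' : HasFDerivAt φ φ' x) :
    φ x + φ' (y - x) ≤ φ y := by
  have hderiv : HasDerivAt (φ ∘ AffineMap.lineMap (k := ℝ) x y) (φ' (y - x)) 0 := by
    refine HasFDerivAt.comp_hasDerivAt 0 ?_ AffineMap.hasDerivAt_lineMap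
    rwa [AffineMap.lineMap_apply_zero]
  have hslope := (hφ.comp_affineMap (AffineMap.lineMap (k := ℝ) x y)).le_slope_of_hasDerivAt
    (x := 0) (y := 1) (by simpa using hx) (by simpa using hy) one_pos hderiv
  simp only [slope_def_field, Function.comp_apply, AffineMap.lineMap_apply_one,
    AffineMap.lineMap_apply_zero, sub_zero, div_one] at hslope
  linarith


/-- A variational equilibrium of the globally-aware constrained game is a
generalized Nash equilibrium: if `ustar ∈ S` satisfies the variational
inequality for the pseudo-gradient, then no feasible unilateral deviation
improves any player's cost. -/
theorem ve_is_gne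
    {ι : Type*} [Fintype ι] [Nonempty ι] [DecidableEq ι]
    (K : ι → ℕ)
    (U : ∀ i, Set (EuclideanSpace ℝ (Fin (K i))))
    (f : ι → (∀ i, EuclideanSpace ℝ (Fin (K i))) → ℝ)
    {M : Type*} [Fintype M]
    (g : M → (∀ i, EuclideanSpace ℝ (Fin (K i))) → ℝ)
    (S : Set (∀ i, EuclideanSpace ℝ (Fin (K i))))
    (hS : S = {u | (∀ i, u i ∈ U i) ∧ ∀ m : M, g m u ≤ 0})
    (hdiff : ∀ (i : ι) (u : ∀ j, EuclideanSpace ℝ (Fin (K j))),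
      Differentiable ℝ (fun v => f i (Function.update u i v)))
    (hconv : ∀ (i : ι) (u : ∀ j, EuclideanSpace ℝ (Fin (K j))),
      ConvexOn ℝ Set.univ (fun v => f i (Function.update u i v)))
    (ustar : ∀ i, EuclideanSpace ℝ (Fin (K i)))
    (hfeas : ustar ∈ S)
    (hVI : ∀ u ∈ S,
      0 ≤ ∑ i : ι,
        (fderiv ℝ (fun v => f i (Function.update ustar i v)) (ustar i))
          (u i - ustar i)) :
    ∀ (i : ι) (v : EuclideanSpace ℝ (Fin (K i))),
      Function.update ustar i v ∈ S →
      f i ustar ≤ f i (Function.update ustar i v) := by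
  intro i v hv
  have hsum := hVI _ hv
  rw [Finset.sum_eq_single_of_mem i (Finset.mem_univ i) fun j _ hj => by
    rw [Function.update_of_ne hj, sub_self, map_zero], Function.update_self] at hsum
  have hgrad := (hconv i ustar).add_hasFDerivAt_le (Set.mem_univ (ustar i)) (Set.mem_univ v)
    (hdiff i ustar (ustar i)).hasFDerivAt
  rw [Function.update_eq_self] at hgrad
  linarith
end

section
/- Let u* be a profile of a locally-aware constrained network game such that u* i ∈ Ω i u* for every player i (feasibility), and such that the augmented objective satisfies Σ_{i} f i u* ≤ Σ_{i} f i (Function.update u* i (v i)) for every choice function v with v i ∈ Ω i u* for all i. Then u* is a generalized Nash equilibrium of the game. -/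
/-- Sufficiency of the augmented-objective condition: if `u` is feasible and
minimizes the aggregate cost `∑ i, f i (update u i (v i))` over all feasible
choice functions `v`, then `u` is a generalized Nash equilibrium of the
locally-aware constrained game. -/
theorem augmented_objective_implies_gne
    {ι : Type*} [Fintype ι] [Nonempty ι] [DecidableEq ι]
    {E : ι → Type*}
    (U : ∀ i, Set (E i))
    (hUne : ∀ i, (U i).Nonempty)
    (f : ι → (∀ i, E i) → ℝ)
    {M : Type*} [Fintype M]
    (g : M → (∀ i, E i) → ℝ)
    (Aw : ι → Set M)
    (𝒩 : ι → Set ι) (h𝒩 : ∀ i, i ∈ 𝒩 i)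
    (A : ι → Set M) (hA : ∀ i, A i = ⋃ j ∈ 𝒩 i, Aw j)
    (Ω : ∀ i, (∀ j, E j) → Set (E i))
    (hΩ : ∀ i u, Ω i u = {v ∈ U i | ∀ m ∈ A i, g m (Function.update u i v) ≤ 0})
    (u : ∀ i, E i)
    (hfeas : ∀ i, u i ∈ Ω i u)
    (haug : ∀ v : ∀ i, E i, (∀ i, v i ∈ Ω i u) →
      ∑ i : ι, f i u ≤ ∑ i : ι, f i (Function.update u i (v i))) :
    ∀ i : ι, u i ∈ Ω i u ∧
      ∀ v ∈ Ω i u, f i u ≤ f i (Function.update u i v) := by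
  refine fun i => ⟨hfeas i, fun v hv => ?_⟩
  by_contra! hlt
  have hmem : ∀ j, Function.update u i v j ∈ Ω j u := by
    intro j
    rcases eq_or_ne j i with rfl | hj
    · simpa using hv
    · simpa [hj] using hfeas j
  refine (haug _ hmem).not_gt (Finset.sum_lt_sum (fun j _ => ?_) ⟨i, Finset.mem_univ i, ?_⟩)
  · rcases eq_or_ne j i with rfl | hj
    · simpa using hlt.le
    · simp [hj]
  · simpa using hlt
end

section
/- In a locally-aware constrained network game with finite player set ι and finite known constraint sets A i, define for profiles v, u (with all components in the action sets) and multiplier families μ (assigning to each player i and each m ∈ A i a nonnegative real μ i m) the augmented Lagrangian 𝓛(v; u; μ) = Σ_{i} ( f i (Function.update u i (v i)) + Σ_{m ∈ A i} μ i m · g m (Function.update u i (v i)) ), and the extended-real valued function Φ_{u}(v) = ⨆_{μ ≥ 0} (𝓛(v; u; μ) : EReal). Let u* be a feasible profile, i.e., u* i ∈ Ω i u* for every i. Then u* is a generalized Nash equilibrium if and only if Φ_{u*}(u*) ≤ Φ_{u*}(v) for every v with v i ∈ U i for all i. -/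
/-- If every constraint value is nonpositive, the supremum of the Lagrangian over nonnegative
multipliers is attained at `μ = 0`. -/
theorem iSup_lagrangian_eq_of_nonpos {ι M : Type*} [Fintype ι] (A : ι → Finset M)
    (a : ι → ℝ) (c : ι → M → ℝ) (hc : ∀ i, ∀ m ∈ A i, c i m ≤ 0) :
    (⨆ μ : {μ : ι → M → ℝ // ∀ i m, 0 ≤ μ i m},
      ((∑ i, (a i + ∑ m ∈ A i, μ.1 i m * c i m) : ℝ) : EReal)) = ((∑ i, a i : ℝ) : EReal) := by
  apply le_antisymm
  · refine iSup_le fun μ => EReal.coe_le_coe_iff.2 (Finset.sum_le_sum fun i _ => ?_)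
    have h := Finset.sum_nonpos fun m hm =>
      mul_nonpos_of_nonneg_of_nonpos (μ.2 i m) (hc i m hm)
    linarith
  · refine le_iSup_of_le ⟨fun _ _ => 0, fun _ _ => le_rfl⟩ ?_
    simp

/-- If some constraint value is positive, the Lagrangian is unbounded above over nonnegative
multipliers. -/
theorem iSup_lagrangian_eq_top_of_pos {ι M : Type*} [Fintype ι] (A : ι → Finset M)
    (a : ι → ℝ) (c : ι → M → ℝ) {i₀ : ι} {m₀ : M} (hm₀ : m₀ ∈ A i₀) (hc : 0 < c i₀ m₀) :
    (⨆ μ : {μ : ι → M → ℝ // ∀ i m, 0 ≤ μ i m},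
      ((∑ i, (a i + ∑ m ∈ A i, μ.1 i m * c i m) : ℝ) : EReal)) = ⊤ := by
  classical
  refine EReal.eq_top_iff_forall_lt _ |>.2 fun y => ?_
  set t : ℝ := (|y - ∑ i, a i| + 1) / c i₀ m₀
  have ht0 : 0 ≤ t := by positivity
  refine lt_of_lt_of_le ?_ (le_iSup _ ⟨fun i m => if i = i₀ then if m = m₀ then t else 0 else 0,
    fun i m => by dsimp only; split_ifs <;> first | exact ht0 | exact le_rfl⟩)
  have hmul : t * c i₀ m₀ = |y - ∑ i, a i| + 1 := div_mul_cancel₀ _ hc.ne'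
  have hsum : ∑ i, ∑ m ∈ A i, (if i = i₀ then if m = m₀ then t else 0 else 0) * c i m
      = |y - ∑ i, a i| + 1 := by
    rw [← hmul, Finset.sum_eq_single i₀ (fun i _ hi => by simp [hi]) (by simp),
      Finset.sum_eq_single m₀ (fun m _ hm => by simp [hm]) (fun h => absurd hm₀ h)]
    simp
  rw [EReal.coe_lt_coe_iff, Finset.sum_add_distrib, hsum]
  linarith [le_abs_self (y - ∑ i, a i)]


/-- Necessary and sufficient characterization of GNEs via the augmented
Lagrangian: a feasible profile `u` is a generalized Nash equilibrium if and
only if `u` minimizes `v ↦ ⨆_{μ ≥ 0} 𝓛(v; u; μ)` (values in `EReal`) over all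
`v` with `v i ∈ U i`. -/
theorem gne_iff_minimax_lagrangian
    {ι : Type*} [Fintype ι] [Nonempty ι] [DecidableEq ι]
    {E : ι → Type*}
    (U : ∀ i, Set (E i))
    (hUne : ∀ i, (U i).Nonempty)
    (f : ι → (∀ i, E i) → ℝ)
    {M : Type*}
    (g : M → (∀ i, E i) → ℝ)
    (A : ι → Finset M)
    -- the augmented Lagrangian 𝓛(v; u; μ)
    (L : (∀ i, E i) → (∀ i, E i) → (ι → M → ℝ) → ℝ)
    (hL : ∀ v u μ, L v u μ =
      ∑ i : ι, (f i (Function.update u i (v i)) +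
        ∑ m ∈ A i, μ i m * g m (Function.update u i (v i))))
    -- Φ u v = ⨆_{μ ≥ 0} 𝓛(v; u; μ), taken in the extended reals
    (Φ : (∀ i, E i) → (∀ i, E i) → EReal)
    (hΦ : ∀ u v, Φ u v =
      ⨆ μ : {μ : ι → M → ℝ // ∀ i m, 0 ≤ μ i m}, ((L v u μ.1 : ℝ) : EReal))
    (u : ∀ i, E i)
    (hfeas : ∀ i : ι, u i ∈ U i ∧ ∀ m ∈ A i, g m u ≤ 0) :
    (∀ i : ι, ∀ v ∈ U i, (∀ m ∈ A i, g m (Function.update u i v) ≤ 0) →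
        f i u ≤ f i (Function.update u i v)) ↔
    (∀ v : ∀ i, E i, (∀ i, v i ∈ U i) → Φ u u ≤ Φ u v) := by
  have hfin : ∀ v : ∀ i, E i, (∀ i, ∀ m ∈ A i, g m (Function.update u i (v i)) ≤ 0) →
      Φ u v = ((∑ i, f i (Function.update u i (v i)) : ℝ) : EReal) := fun v hv => by
    simp only [hΦ, hL]
    exact iSup_lagrangian_eq_of_nonpos A _ (fun i m => g m (Function.update u i (v i))) hv
  have hu : Φ u u = ((∑ i, f i u : ℝ) : EReal) := by
    rw [hfin u fun i => by simpa using (hfeas i).2]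
    simp
  constructor
  · intro h v hvU
    by_cases hv : ∀ i, ∀ m ∈ A i, g m (Function.update u i (v i)) ≤ 0
    · rw [hu, hfin v hv, EReal.coe_le_coe_iff]
      exact Finset.sum_le_sum fun i _ => h i (v i) (hvU i) (hv i)
    · push Not at hv
      obtain ⟨i, m, hm, hpos⟩ := hv
      have htop : Φ u v = ⊤ := by
        simp only [hΦ, hL]
        exact iSup_lagrangian_eq_top_of_pos A _
          (fun i m => g m (Function.update u i (v i))) hm hpos
      exact htop ▸ le_top
  · intro h i v hvU hv
    have hw := h (Function.update u i v) fun j => by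
      rcases eq_or_ne j i with rfl | hj
      · simpa using hvU
      · simpa [hj] using (hfeas j).1
    rw [hu, hfin _ fun j => by
      rcases eq_or_ne j i with rfl | hj
      · simpa using hv
      · simpa [hj] using (hfeas j).2, EReal.coe_le_coe_iff,
      ← Finset.add_sum_erase _ _ (Finset.mem_univ i),
      ← Finset.add_sum_erase _ (fun j => f j (Function.update u j (Function.update u i v j)))
        (Finset.mem_univ i),
      Finset.sum_congr rfl fun j hj => show f j (Function.update u j (Function.update u i v j))
        = f j u by simp [Finset.ne_of_mem_erase hj]] at hw
    simpa only [Function.update_self, add_le_add_iff_right] using hw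
end

section
/- Let A be a finite index set, a : ℝ, and g : A → ℝ. Then the supremum in the extended reals ⨆_{μ : A → ℝ, ∀ m, 0 ≤ μ m} ((a + Σ_{m ∈ A} μ m * g m : ℝ) : EReal) equals (a : EReal) if g m ≤ 0 for every m ∈ A, and equals ⊤ otherwise. -/
/-- The inner maximization over nonnegative Lagrange multipliers of the linear
penalty `a + ∑ m, μ m * g m`, taken in the extended reals, equals `a` when all
constraints `g m ≤ 0` hold, and `⊤` otherwise. -/
theorem sup_lagrange_penalty
    {A : Type*} [Fintype A] (a : ℝ) (g : A → ℝ) :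
    ((∀ m : A, g m ≤ 0) →
      (⨆ μ : {μ : A → ℝ // ∀ m, 0 ≤ μ m},
        ((a + ∑ m : A, μ.1 m * g m : ℝ) : EReal)) = (a : EReal)) ∧
    (¬ (∀ m : A, g m ≤ 0) →
      (⨆ μ : {μ : A → ℝ // ∀ m, 0 ≤ μ m},
        ((a + ∑ m : A, μ.1 m * g m : ℝ) : EReal)) = ⊤) := by
  refine ⟨fun hg => le_antisymm (iSup_le fun μ => ?_) ?_, fun hg => ?_⟩
  · have hsum : ∑ m : A, μ.1 m * g m ≤ 0 :=
      Finset.sum_nonpos fun m _ => mul_nonpos_of_nonneg_of_nonpos (μ.2 m) (hg m)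
    exact EReal.coe_le_coe_iff.2 (by linarith)
  · exact le_iSup_of_le ⟨0, fun _ => le_rfl⟩ (by simp)
  · classical
    push Not at hg
    obtain ⟨k, hk⟩ := hg
    refine (EReal.eq_top_iff_forall_lt _).2 fun y => ?_
    have ht : 0 ≤ (|y - a| + 1) / g k := by positivity
    refine lt_of_lt_of_le ?_ (le_iSup _
      ⟨Pi.single k ((|y - a| + 1) / g k), fun m => Pi.single_nonneg (α := fun _ => ℝ).2 ht m⟩)
    have hsum : ∑ m : A, Pi.single (M := fun _ => ℝ) k ((|y - a| + 1) / g k) m * g m =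
        |y - a| + 1 := by
      simp [Pi.single_apply, div_mul_cancel₀ _ hk.ne']
    refine EReal.coe_lt_coe_iff.2 ?_
    rw [hsum]
    linarith [le_abs_self (y - a)]
end

section
/- (Lagrangian/KKT necessity for GNE.) Consider a locally-aware constrained network game in which each action space is E i = EuclideanSpace ℝ (Fin (K i)), each U i is nonempty, convex and compact, and for every player i and every profile u the maps v ↦ f i (Function.update u i v) and v ↦ g m (Function.update u i v) (for each m ∈ A i) are continuous and convex on E i. Let u* be a generalized Nash equilibrium, and assume Slater's condition at u*: for every i there exists ṽ ∈ U i with g m (Function.update u* i ṽ) < 0 for all m ∈ A i. Then for every player i there exists a family of multipliers μ : A i → ℝ with μ m ≥ 0 for all m, such that Σ_{m ∈ A i} μ m · g m u* = 0 and, for every v ∈ U i, f i u* ≤ f i (Function.update u* i v) + Σ_{m ∈ A i} μ m · g m (Function.update u* i v). -/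
/-- Fan's theorem of the alternative: if finitely many convex functions on a nonempty convex set
are never simultaneously negative, some nontrivial nonnegative combination of them is nonnegative
on that set. -/
theorem ConvexOn.exists_nonneg_sum_mul_nonneg {κ E : Type*} [Fintype κ]
    [AddCommGroup E] [Module ℝ E] {U : Set E} (hne : U.Nonempty) (hU : Convex ℝ U)
    {F : κ → E → ℝ} (hF : ∀ k, ConvexOn ℝ U (F k))
    (h : ¬ ∃ x ∈ U, ∀ k, F k x < 0) :
    ∃ l : κ → ℝ, (∀ k, 0 ≤ l k) ∧ 0 < ∑ k, l k ∧ ∀ x ∈ U, 0 ≤ ∑ k, l k * F k x := by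
  classical
  let s : Set (κ → ℝ) := {y | ∃ x ∈ U, ∀ k, F k x < y k}
  have hs : Convex ℝ s := by
    rintro y ⟨x, hx, hxy⟩ z ⟨w, hw, hwz⟩ a b ha hb hab
    refine ⟨a • x + b • w, hU hx hw ha hb hab, fun k => ?_⟩
    refine ((hF k).2 hx hw ha hb hab).trans_lt ?_
    simp only [smul_eq_mul, Pi.add_apply, Pi.smul_apply]
    rcases ha.eq_or_lt with rfl | ha'
    · obtain rfl : b = 1 := by linarith
      simpa using hwz k
    · exact add_lt_add_of_lt_of_le (mul_lt_mul_of_pos_left (hxy k) ha')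
        (mul_le_mul_of_nonneg_left (hwz k).le hb)
  have hso : IsOpen s := by
    have : s = ⋃ x ∈ U, Set.univ.pi fun k => Set.Ioi (F k x) := by
      ext y
      simp [s]
    rw [this]
    exact isOpen_biUnion fun x _ => isOpen_set_pi Set.finite_univ fun k _ => isOpen_Ioi
  obtain ⟨φ, hφ⟩ := geometric_hahn_banach_open_point hs hso (x := 0) (by simpa [s] using h)
  simp only [map_zero] at hφ
  let l : κ → ℝ := fun k => -φ (Pi.single k 1)
  have hl (y : κ → ℝ) : ∑ k, l k * y k = -φ y := by
    conv_rhs => rw [pi_eq_sum_univ' y]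
    simp [l, mul_comm]
  obtain ⟨x₀, hx₀⟩ := hne
  have hpos {y : κ → ℝ} (hy : y ∈ s) : 0 < ∑ k, l k * y k := by
    rw [hl]
    exact neg_pos.2 (hφ y hy)
  have hshift {x : E} (hx : x ∈ U) {ε : ℝ} (hε : 0 < ε) : (fun k => F k x + ε) ∈ s :=
    ⟨x, hx, fun k => lt_add_of_pos_right _ hε⟩
  have hnonneg (k : κ) : 0 ≤ l k := by
    by_contra! hk
    set y : κ → ℝ := fun k => F k x₀ + 1
    have hy : φ y < 0 := hφ y (hshift hx₀ one_pos)
    have hk' : 0 < φ (Pi.single k 1) := neg_neg_iff_pos.1 hk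
    have ht : 0 ≤ -φ y / φ (Pi.single k 1) := div_nonneg (neg_nonneg.2 hy.le) hk'.le
    have hmem : y + (-φ y / φ (Pi.single k 1)) • Pi.single k 1 ∈ s := by
      refine ⟨x₀, hx₀, fun j => (lt_add_one (F j x₀)).trans_le ?_⟩
      have : 0 ≤ (Pi.single k 1 : κ → ℝ) j := by
        by_cases hj : j = k <;> simp [hj]
      simpa [y] using mul_nonneg ht this
    have := hφ _ hmem
    rw [map_add, map_smul, smul_eq_mul, div_mul_cancel₀ _ hk'.ne'] at this
    linarith
  have hsum : 0 < ∑ k, l k := by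
    refine (Finset.sum_nonneg fun k _ => hnonneg k).lt_of_ne' fun h0 => ?_
    have hz := (Finset.sum_eq_zero_iff_of_nonneg fun k _ => hnonneg k).1 h0
    have := hpos (hshift hx₀ one_pos)
    rw [Finset.sum_eq_zero fun k hk => by rw [hz k hk, zero_mul]] at this
    exact this.false
  refine ⟨l, hnonneg, hsum, fun x hx => ?_⟩
  by_contra! hneg
  have := hpos (hshift hx (div_pos (neg_pos.2 hneg) hsum))
  simp only [mul_add, Finset.sum_add_distrib, ← Finset.sum_mul] at this
  rw [mul_div_cancel₀ _ hsum.ne'] at this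
  linarith

/-- Lagrangian duality for convex programs under Slater's condition: a lower bound for the
constrained problem is attained by the Lagrangian for suitable nonnegative multipliers. -/
theorem ConvexOn.exists_lagrange_multipliers {E M : Type*} [AddCommGroup E] [Module ℝ E]
    {U : Set E} (hU : Convex ℝ U) {f : E → ℝ} {g : M → E → ℝ} {s : Finset M}
    (hf : ConvexOn ℝ U f) (hg : ∀ m ∈ s, ConvexOn ℝ U (g m)) {c : ℝ}
    (hc : ∀ v ∈ U, (∀ m ∈ s, g m v ≤ 0) → c ≤ f v)
    (hslater : ∃ v ∈ U, ∀ m ∈ s, g m v < 0) :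
    ∃ μ : M → ℝ, (∀ m ∈ s, 0 ≤ μ m) ∧ ∀ v ∈ U, c ≤ f v + ∑ m ∈ s, μ m * g m v := by
  classical
  obtain ⟨w, hw, hgw⟩ := hslater
  let F : Option s → E → ℝ := fun o => o.elim (fun v => f v + -c) (fun m => g m)
  have hF : ∀ o, ConvexOn ℝ U (F o) := by
    rintro (_ | m)
    · exact hf.add_const (-c)
    · exact hg m m.2
  obtain ⟨l, hl, hsum, hpos⟩ := ConvexOn.exists_nonneg_sum_mul_nonneg ⟨w, hw⟩ hU hF (by
    rintro ⟨v, hv, h⟩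
    have h1 : f v + -c < 0 := h none
    have h2 := hc v hv fun m hm => (h (some ⟨m, hm⟩)).le
    linarith)
  simp only [Fintype.sum_option] at hsum hpos
  have hl0 : 0 < l none := by
    refine (hl none).lt_of_ne' fun h0 => ?_
    rw [h0, zero_add] at hsum
    obtain ⟨m, -, hm⟩ := Finset.exists_lt_of_sum_lt (f := fun _ => (0 : ℝ)) (by simpa using hsum)
    have h1 := hpos w hw
    rw [h0, zero_mul, zero_add] at h1
    refine h1.not_gt (Finset.sum_neg' (fun m _ => ?_) ⟨m, Finset.mem_univ m, ?_⟩)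
    · exact mul_nonpos_of_nonneg_of_nonpos (hl _) (hgw m m.2).le
    · exact mul_neg_of_pos_of_neg hm (hgw m m.2)
  refine ⟨fun m => if hm : m ∈ s then l (some ⟨m, hm⟩) / l none else 0, fun m hm => ?_,
    fun v hv => ?_⟩
  · simpa [hm] using div_nonneg (hl _) hl0.le
  · have h1 : 0 ≤ l none * (f v + -c) + ∑ m : s, l (some m) * g m v := hpos v hv
    rw [← Finset.sum_coe_sort s]
    simp only [Finset.coe_mem, dite_true, Subtype.coe_eta, div_mul_eq_mul_div, ← Finset.sum_div]
    rw [← sub_nonneg]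
    have h2 := div_nonneg h1 hl0.le
    rw [add_div, mul_div_cancel_left₀ _ hl0.ne'] at h2
    linarith


/-- Lagrangian/KKT necessity for GNE: at a generalized Nash equilibrium of a
locally-aware constrained network game on Euclidean action spaces with convex
data and Slater's condition, every player admits nonnegative multipliers
satisfying complementary slackness and Lagrangian minimality. -/
theorem lagrangian_necessity_gne
    {ι : Type*} [Fintype ι] [Nonempty ι] [DecidableEq ι]
    (K : ι → ℕ)
    (U : ∀ i, Set (EuclideanSpace ℝ (Fin (K i))))
    (hUne : ∀ i, (U i).Nonempty)
    (hUconv : ∀ i, Convex ℝ (U i))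
    (hUcomp : ∀ i, IsCompact (U i))
    (f : ι → (∀ i, EuclideanSpace ℝ (Fin (K i))) → ℝ)
    {M : Type*}
    (g : M → (∀ i, EuclideanSpace ℝ (Fin (K i))) → ℝ)
    (A : ι → Finset M)
    (hfcont : ∀ (i : ι) (u : ∀ j, EuclideanSpace ℝ (Fin (K j))),
      Continuous (fun v => f i (Function.update u i v)))
    (hfconv : ∀ (i : ι) (u : ∀ j, EuclideanSpace ℝ (Fin (K j))),
      ConvexOn ℝ Set.univ (fun v => f i (Function.update u i v)))
    (hgcont : ∀ (i : ι) (u : ∀ j, EuclideanSpace ℝ (Fin (K j))), ∀ m ∈ A i,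
      Continuous (fun v => g m (Function.update u i v)))
    (hgconv : ∀ (i : ι) (u : ∀ j, EuclideanSpace ℝ (Fin (K j))), ∀ m ∈ A i,
      ConvexOn ℝ Set.univ (fun v => g m (Function.update u i v)))
    (u : ∀ i, EuclideanSpace ℝ (Fin (K i)))
    (hGNE : ∀ i : ι,
      (u i ∈ U i ∧ ∀ m ∈ A i, g m u ≤ 0) ∧
      (∀ v ∈ U i, (∀ m ∈ A i, g m (Function.update u i v) ≤ 0) →
        f i u ≤ f i (Function.update u i v)))
    (hSlater : ∀ i : ι, ∃ vtil ∈ U i,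
      ∀ m ∈ A i, g m (Function.update u i vtil) < 0) :
    ∀ i : ι, ∃ μ : M → ℝ,
      (∀ m ∈ A i, 0 ≤ μ m) ∧
      (∑ m ∈ A i, μ m * g m u = 0) ∧
      (∀ v ∈ U i, f i u ≤ f i (Function.update u i v) +
        ∑ m ∈ A i, μ m * g m (Function.update u i v)) := by
  intro i
  obtain ⟨⟨hui, hgu⟩, hmin⟩ := hGNE i
  obtain ⟨μ, hμ, hL⟩ := ConvexOn.exists_lagrange_multipliers (hUconv i)
    ((hfconv i u).subset (Set.subset_univ _) (hUconv i))
    (fun m hm => (hgconv i u m hm).subset (Set.subset_univ _) (hUconv i)) hmin (hSlater i)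
  refine ⟨μ, hμ, le_antisymm ?_ ?_, hL⟩
  · exact Finset.sum_nonpos fun m hm => mul_nonpos_of_nonneg_of_nonpos (hμ m hm) (hgu m hm)
  · simpa using hL (u i) hui
end

section
/- Let α, β, k₁, k₂, q₁, q₂ be positive reals and μ₁, μ₂ ≥ 0. For i ∈ {1,2} define the Cournot Lagrangian L_i(v, w) = k_i·v² − (α − β·(v + w))·v + μ_i·(q_i − v − w), where v is firm i's output and w the other firm's output. Set H = 4(k₁ + β)(k₂ + β) − β². Then H > 0, and the pair (v₁*, v₂*) with v_i* = (2(k_{3−i} + β)(α + μ_i) − β·(α + μ_{3−i}))/H is the unique pair of reals such that v₁* minimizes v ↦ L₁(v, v₂*) over ℝ and v₂* minimizes w ↦ L₂(w, v₁*) over ℝ; i.e., it is the unique Nash equilibrium of the inner unconstrained Lagrangian game arising in the dual Cournot game. -/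
/-- A firm's output minimizes its Cournot Lagrangian against a fixed opponent output `w` if and
only if it satisfies the first-order condition. -/
theorem cournot_lagrangian_minimizer_iff {α β k : ℝ} (hk : 0 < k + β) (q μ x w : ℝ) :
    (∀ v : ℝ,
        k * x ^ 2 - (α - β * (x + w)) * x + μ * (q - x - w) ≤
        k * v ^ 2 - (α - β * (v + w)) * v + μ * (q - v - w)) ↔
      2 * (k + β) * x + β * w = α + μ := by
  constructor
  · intro h
    obtain ⟨y, hy⟩ : ∃ y : ℝ, 2 * (k + β) * y + β * w = α + μ :=
      ⟨(α + μ - β * w) / (2 * (k + β)), by field_simp; ring⟩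
    have hxy : (k + β) * (x - y) ^ 2 ≤ 0 := by
      linear_combination h y - (x - y) * hy
    have hzero : (x - y) ^ 2 = 0 :=
      le_antisymm (nonpos_of_mul_nonpos_right hxy hk) (sq_nonneg _)
    rw [sub_eq_zero.mp (pow_eq_zero_iff two_ne_zero |>.mp hzero)]
    exact hy
  · intro h v
    have hvx : 0 ≤ (k + β) * (v - x) ^ 2 := mul_nonneg hk.le (sq_nonneg _)
    linear_combination hvx + (x - v) * h

/-- The inner unconstrained Lagrangian game of the dual Cournot game: with
fixed nonnegative multipliers `μ₁, μ₂`, the Lagrangians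
`L_i(v, w) = k_i v² − (α − β(v + w)) v + μ_i (q_i − v − w)` admit a unique
Nash equilibrium, given in closed form with `H = 4(k₁+β)(k₂+β) − β² > 0`. -/
theorem dual_cournot_inner_game_unique_ne
    (α β k₁ k₂ q₁ q₂ μ₁ μ₂ : ℝ)
    (hα : 0 < α) (hβ : 0 < β) (hk₁ : 0 < k₁) (hk₂ : 0 < k₂)
    (hq₁ : 0 < q₁) (hq₂ : 0 < q₂) (hμ₁ : 0 ≤ μ₁) (hμ₂ : 0 ≤ μ₂) :
    0 < 4 * (k₁ + β) * (k₂ + β) - β ^ 2 ∧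
    ∀ v₁ v₂ : ℝ,
      ((∀ v : ℝ,
          k₁ * v₁ ^ 2 - (α - β * (v₁ + v₂)) * v₁ + μ₁ * (q₁ - v₁ - v₂) ≤
          k₁ * v ^ 2 - (α - β * (v + v₂)) * v + μ₁ * (q₁ - v - v₂)) ∧
       (∀ w : ℝ,
          k₂ * v₂ ^ 2 - (α - β * (v₂ + v₁)) * v₂ + μ₂ * (q₂ - v₂ - v₁) ≤
          k₂ * w ^ 2 - (α - β * (w + v₁)) * w + μ₂ * (q₂ - w - v₁))) ↔
      (v₁ = (2 * (k₂ + β) * (α + μ₁) - β * (α + μ₂)) /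
              (4 * (k₁ + β) * (k₂ + β) - β ^ 2) ∧
       v₂ = (2 * (k₁ + β) * (α + μ₂) - β * (α + μ₁)) /
              (4 * (k₁ + β) * (k₂ + β) - β ^ 2)) := by
  have hH : 0 < 4 * (k₁ + β) * (k₂ + β) - β ^ 2 := by
    have : 0 < 4 * k₁ * k₂ + 4 * k₁ * β + 4 * k₂ * β + 3 * β ^ 2 := by positivity
    linear_combination this
  refine ⟨hH, fun v₁ v₂ => ?_⟩
  rw [cournot_lagrangian_minimizer_iff (add_pos hk₁ hβ),
    cournot_lagrangian_minimizer_iff (add_pos hk₂ hβ), eq_div_iff hH.ne', eq_div_iff hH.ne']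
  constructor
  · rintro ⟨h₁, h₂⟩
    constructor
    · linear_combination 2 * (k₂ + β) * h₁ - β * h₂
    · linear_combination 2 * (k₁ + β) * h₂ - β * h₁
  · rintro ⟨h₁, h₂⟩
    constructor <;> apply mul_right_cancel₀ hH.ne'
    · linear_combination 2 * (k₁ + β) * h₁ + β * h₂
    · linear_combination 2 * (k₂ + β) * h₂ + β * h₁
end
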